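/- arXiv:1807.09903 — 3 statements merged into one kernel-verified Lean document; each statement's English description precedes it below -/
import Mathlib

section
/- Let λ ∈ ℝ and define the entire function K : ℂ → ℂ by K(ζ) := Σ_{k=0}^∞ ((−λ²/4)^k/(k!)²)·ζ^k, and let K' denote its complex derivative. Let Ω ⊆ ℂ be open, connected, symmetric under complex conjugation, with Ω ∩ ℝ ≠ ∅. Let u : ℂ → ℝ be twice continuously differentiable on Ω with Δu + λ²·u = 0 on Ω, and let Φ, Ψ be holomorphic on Ω such that for every real x ∈ Ω: Φ(x) = u(x) and Ψ(x) equals the derivative at t = 0 of t ↦ u(x + i·t). Then for every z₀ ∈ Ω such that the straight segment [conj z₀, z₀] is contained in Ω, writing w₀ := conj z₀: u(z₀) = (Φ(z₀) + Φ(w₀))/2 − ((z₀ − w₀)/2)·∫_{[w₀,z₀]} Φ(z)·K'((z − z₀)·(z − w₀)) dz − (i/2)·∫_{[w₀,z₀]} K((z − z₀)·(z − w₀))·Ψ(z) dz. -/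
open Complex

/-- Complex contour integral along the straight segment from `p` to `q`. -/
noncomputable def segIntegral (f : ℂ → ℂ) (p q : ℂ) : ℂ :=
  (q - p) * ∫ t in (0:ℝ)..1, f (p + (t : ℂ) * (q - p))

/-- The entire function `K(ζ) = Σ_{k≥0} ((−λ²/4)^k/(k!)²) ζ^k`, so that
`K((z−z₀)(z−w₀)) = J₀(λ√((z−z₀)(z−w₀)))` is the Riemann function of the
Helmholtz operator. -/
noncomputable def besselKernel (lam : ℝ) (ζ : ℂ) : ℂ :=
  ∑' n : ℕ, ((-(lam : ℂ) ^ 2 / 4) ^ n / ((n.factorial : ℂ)) ^ 2) * ζ ^ n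

section Carleman
open MeasureTheory Filter Topology

/-- integration by parts for real C¹ functions with compact support -/
lemma hc_ibp {p q : ℂ → ℝ} (hp : ContDiff ℝ 1 p) (hq : ContDiff ℝ 1 q)
    (hcp : HasCompactSupport p) (v : ℂ) :
    ∫ z, fderiv ℝ p z v * q z = - ∫ z, p z * fderiv ℝ q z v := by
  have hp' : Continuous (fun z => fderiv ℝ p z v) :=
    (hp.continuous_fderiv (by norm_num)).clm_apply continuous_const
  have hq' : Continuous (fun z => fderiv ℝ q z v) :=
    (hq.continuous_fderiv (by norm_num)).clm_apply continuous_const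
  have hcp' : HasCompactSupport (fun z => fderiv ℝ p z v) := hcp.fderiv_apply (𝕜 := ℝ) v
  rw [integral_mul_fderiv_eq_neg_fderiv_mul_of_integrable, neg_neg]
  · exact (hp'.mul hq.continuous).integrable_of_hasCompactSupport hcp'.mul_right
  · exact (hp.continuous.mul hq').integrable_of_hasCompactSupport hcp.mul_right
  · exact (hp.continuous.mul hq.continuous).integrable_of_hasCompactSupport hcp.mul_right
  · intro x _; exact hp.differentiable (by norm_num) x
  · intro x _; exact hq.differentiable (by norm_num) x

lemma hc_null {p q : ℂ → ℝ} (hp : ContDiff ℝ 1 p) (hq : ContDiff ℝ 1 q)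
    (hcp : HasCompactSupport p) (hcq : HasCompactSupport q) (v w : ℂ) :
    ∫ z, fderiv ℝ q z w * fderiv ℝ p z v = ∫ z, fderiv ℝ p z w * fderiv ℝ q z v := by
  obtain ⟨C, hC⟩ := hp.lipschitzWith_of_hasCompactSupport hcp (by norm_num)
  obtain ⟨D, hD⟩ := hq.lipschitzWith_of_hasCompactSupport hcq (by norm_num)
  have hp' : Continuous (fun z => fderiv ℝ p z v) :=
    (hp.continuous_fderiv (by norm_num)).clm_apply continuous_const
  have hq' : Continuous (fun z => fderiv ℝ q z v) :=
    (hq.continuous_fderiv (by norm_num)).clm_apply continuous_const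
  have hcp' : HasCompactSupport (fun z => fderiv ℝ p z v) := hcp.fderiv_apply (𝕜 := ℝ) v
  have hcq' : HasCompactSupport (fun z => fderiv ℝ q z v) := hcq.fderiv_apply (𝕜 := ℝ) v
  have A := hD.integral_inv_smul_sub_mul_tendsto_integral_lineDeriv_mul (μ := volume)
    (hp'.integrable_of_hasCompactSupport hcp') w
  have B := hC.integral_inv_smul_sub_mul_tendsto_integral_lineDeriv_mul (μ := volume)
    (hq'.integrable_of_hasCompactSupport hcq') (-w)
  have e1 : ∀ z w, lineDeriv ℝ q z w = fderiv ℝ q z w := fun z w =>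
    (hq.differentiable (by norm_num) z).lineDeriv_eq_fderiv
  have e2 : ∀ z w, lineDeriv ℝ p z w = fderiv ℝ p z w := fun z w =>
    (hp.differentiable (by norm_num) z).lineDeriv_eq_fderiv
  simp only [e1, e2] at A B
  have key : ∀ t : ℝ, ∫ x, t⁻¹ • (q (x + t • w) - q x) * fderiv ℝ p x v
      = - ∫ x, t⁻¹ • (p (x + t • (-w)) - p x) * fderiv ℝ q x v := by
    intro t
    have hQ : ContDiff ℝ 1 (fun x => q (x + t • w)) := hq.comp (contDiff_id.add contDiff_const)
    have hd : ContDiff ℝ 1 (fun x => q (x + t • w) - q x) := hQ.sub hq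
    have h1 := hc_ibp hp hd hcp v
    have h2 : ∀ x, fderiv ℝ (fun x => q (x + t • w) - q x) x v
        = fderiv ℝ q (x + t • w) v - fderiv ℝ q x v := by
      intro x
      rw [fderiv_fun_sub (hQ.differentiable (by norm_num) x) (hq.differentiable (by norm_num) x),
        fderiv_comp_add_right]
      rfl
    have hi0 : Integrable (fun x => p x * fderiv ℝ q x v) :=
      (hp.continuous.mul hq').integrable_of_hasCompactSupport hcp.mul_right
    have hi1 : Integrable (fun x => p x * fderiv ℝ q (x + t • w) v) :=
      (hp.continuous.mul (hq'.comp (continuous_id.add continuous_const))).integrable_of_hasCompactSupport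
        hcp.mul_right
    have h3 : ∫ x, p x * fderiv ℝ q (x + t • w) v = ∫ x, p (x + t • (-w)) * fderiv ℝ q x v := by
      rw [← integral_add_right_eq_self (μ := volume)
        (fun x => p (x + t • (-w)) * fderiv ℝ q x v) (t • w)]
      congr 1; ext x; congr 2; simp
    have hi2 : Integrable (fun x => p (x + t • (-w)) * fderiv ℝ q x v) :=
      ((hp.continuous.comp (continuous_id.add continuous_const)).mul
        hq').integrable_of_hasCompactSupport hcq'.mul_left
    have : ∀ x, t⁻¹ • (q (x + t • w) - q x) * fderiv ℝ p x v
       = t⁻¹ * (fderiv ℝ p x v * (q (x + t • w) - q x)) := by intro x; simp; ring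
    simp_rw [this]
    have : ∀ x, t⁻¹ • (p (x + t • (-w)) - p x) * fderiv ℝ q x v
       = t⁻¹ * (p (x + t • (-w)) * fderiv ℝ q x v - p x * fderiv ℝ q x v) := by
      intro x; simp only [smul_eq_mul]; ring
    simp_rw [this]
    rw [integral_const_mul, integral_const_mul, h1, integral_sub hi2 hi0]
    simp_rw [h2, mul_sub]
    rw [integral_sub hi1 hi0, h3]
    ring
  simp_rw [key] at A
  have := tendsto_nhds_unique A B.neg
  rw [this, ← integral_neg]
  congr 1; ext x; simp

lemma hc_re_fderiv {h : ℂ → ℂ} {z : ℂ} (hd : DifferentiableAt ℝ h z) (v : ℂ) :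
    fderiv ℝ (fun z => (h z).re) z v = (fderiv ℝ h z v).re := by
  have := (reCLM.hasFDerivAt.comp z hd.hasFDerivAt).fderiv
  have e : (fun z => (h z).re) = (reCLM ∘ h) := rfl
  rw [e, this]; rfl

lemma hc_im_fderiv {h : ℂ → ℂ} {z : ℂ} (hd : DifferentiableAt ℝ h z) (v : ℂ) :
    fderiv ℝ (fun z => (h z).im) z v = (fderiv ℝ h z v).im := by
  have := (imCLM.hasFDerivAt.comp z hd.hasFDerivAt).fderiv
  have e : (fun z => (h z).im) = (imCLM ∘ h) := rfl
  rw [e, this]; rfl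

lemma hc_sq {r : ℂ → ℝ} (hr : HasCompactSupport r) : HasCompactSupport (fun z => r z ^ 2) := by
  simp_rw [sq]; exact hr.mul_right

lemma hc_int {f : ℂ → ℂ} (hf : Continuous f) (hc : HasCompactSupport f) :
    Integrable (fun z => ‖f z‖ ^ 2) := by
  apply (hf.norm.pow 2).integrable_of_hasCompactSupport
  exact hc_sq hc.norm

lemma hc_poincare_real {p : ℂ → ℝ} (hp : ContDiff ℝ 1 p) (hcp : HasCompactSupport p)
    {ε : ℝ} (hs : ∀ z, p z ≠ 0 → |z.re| ≤ ε) :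
    ∫ z, p z ^ 2 ≤ 4 * ε ^ 2 * ∫ z, (fderiv ℝ p z 1) ^ 2 := by
  have hp' : Continuous (fun z => fderiv ℝ p z 1) :=
    (hp.continuous_fderiv (by norm_num)).clm_apply continuous_const
  have hcp' : HasCompactSupport (fun z => fderiv ℝ p z 1) := hcp.fderiv_apply (𝕜 := ℝ) 1
  have hp2 : ContDiff ℝ 1 (fun z => p z ^ 2) := hp.pow 2
  have hcp2 : HasCompactSupport (fun z => p z ^ 2) := hc_sq hcp
  have h1 := hc_ibp hp2 (q := fun z => z.re) reCLM.contDiff hcp2 1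
  have e1 : ∀ z : ℂ, fderiv ℝ (fun z : ℂ => z.re) z 1 = 1 := by
    intro z
    have : (fun z : ℂ => z.re) = reCLM := rfl
    rw [this, reCLM.fderiv]; simp
  have e2 : ∀ z, fderiv ℝ (fun z => p z ^ 2) z 1 = 2 * p z * fderiv ℝ p z 1 := by
    intro z
    have := ((hp.differentiable (by norm_num) z).hasFDerivAt.pow 2).fderiv
    rw [this]; simp
  simp only [e1, e2, mul_one] at h1
  have i1 : Integrable (fun z => p z ^ 2) := hp2.continuous.integrable_of_hasCompactSupport hcp2
  have i2 : Integrable (fun z => (fderiv ℝ p z 1) ^ 2) :=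
    (hp'.pow 2).integrable_of_hasCompactSupport (hc_sq hcp')
  have i3 : Integrable (fun z => 2 * p z * fderiv ℝ p z 1 * z.re) :=
    (((continuous_const.mul hp.continuous).mul hp').mul
      continuous_re).integrable_of_hasCompactSupport (hcp'.mul_left.mul_right)
  have : ∫ z, -(2 * p z * fderiv ℝ p z 1 * z.re)
      ≤ ∫ z, ((1/2) * p z ^ 2 + 2 * ε ^ 2 * (fderiv ℝ p z 1) ^ 2) := by
    apply integral_mono i3.neg ((i1.const_mul _).add (i2.const_mul _))
    intro z
    show -(2 * p z * fderiv ℝ p z 1 * z.re) ≤ (1/2) * p z ^ 2 + 2 * ε ^ 2 * (fderiv ℝ p z 1) ^ 2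
    by_cases hz : p z = 0
    · simp only [hz]; simp; positivity
    · have h2 : z.re ^ 2 ≤ ε ^ 2 := by
        rw [← sq_abs]; exact pow_le_pow_left₀ (abs_nonneg _) (hs z hz) 2
      nlinarith [sq_nonneg (p z + 2 * z.re * fderiv ℝ p z 1),
        mul_le_mul_of_nonneg_right h2 (sq_nonneg (fderiv ℝ p z 1))]
  rw [integral_neg, h1, neg_neg, integral_add (i1.const_mul _) (i2.const_mul _),
    integral_const_mul, integral_const_mul] at this
  linarith

/-- The L² estimate for `∂̄` (σ = 1) and `∂` (σ = -1) on a thin strip. -/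
lemma hc_dbar {h : ℂ → ℂ} (hh : ContDiff ℝ 1 h) (hc : HasCompactSupport h)
    {ε : ℝ} (hs : ∀ z, h z ≠ 0 → |z.re| ≤ ε) {c : ℝ} (hc1 : c ^ 2 = 1) :
    ∫ z, ‖h z‖ ^ 2 ≤ 4 * ε ^ 2 * ∫ z, ‖fderiv ℝ h z 1 + c * I * fderiv ℝ h z I‖ ^ 2 := by
  have hd : ∀ z, DifferentiableAt ℝ h z := fun z => hh.differentiable (by norm_num) z
  set p : ℂ → ℝ := fun z => (h z).re with hpdef
  set q : ℂ → ℝ := fun z => (h z).im with hqdef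
  have hp : ContDiff ℝ 1 p := reCLM.contDiff.comp hh
  have hq : ContDiff ℝ 1 q := imCLM.contDiff.comp hh
  have hcp : HasCompactSupport p := hc.comp_left (g := re) zero_re
  have hcq : HasCompactSupport q := hc.comp_left (g := im) zero_im
  have hC : ∀ {r : ℂ → ℝ}, ContDiff ℝ 1 r → ∀ v, Continuous (fun z => fderiv ℝ r z v) :=
    fun hr v => (hr.continuous_fderiv (by norm_num)).clm_apply continuous_const
  have hCC : ∀ {r : ℂ → ℝ}, HasCompactSupport r → ∀ v,
    HasCompactSupport (fun z => fderiv ℝ r z v) := fun hr v => hr.fderiv_apply (𝕜 := ℝ) v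
  have hI : ∀ {r s : ℂ → ℝ}, ContDiff ℝ 1 r → HasCompactSupport r → ContDiff ℝ 1 s →
     ∀ v w, Integrable (fun z => fderiv ℝ r z v * fderiv ℝ s z w) := fun hr hcr hs v w =>
    ((hC hr v).mul (hC hs w)).integrable_of_hasCompactSupport (hCC hcr v).mul_right
  have P1 := hc_poincare_real hp hcp (ε := ε) (fun z hz => hs z (by
    intro h0; apply hz; simp [hpdef, h0]))
  have P2 := hc_poincare_real hq hcq (ε := ε) (fun z hz => hs z (by
    intro h0; apply hz; simp [hqdef, h0]))
  have N := hc_null hp hq hcp hcq 1 I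
  have e0 : ∀ z, ‖h z‖ ^ 2 = p z ^ 2 + q z ^ 2 := by
    intro z; rw [← normSq_eq_norm_sq, normSq_apply]; simp only [hpdef, hqdef]; ring
  have e1 : ∀ z, ‖fderiv ℝ h z 1 + c * I * fderiv ℝ h z I‖ ^ 2
      = (fderiv ℝ p z 1) ^ 2 + (fderiv ℝ q z 1) ^ 2 + ((fderiv ℝ p z I) ^ 2 + (fderiv ℝ q z I) ^ 2)
        + 2 * c * (fderiv ℝ p z I * fderiv ℝ q z 1 - fderiv ℝ q z I * fderiv ℝ p z 1) := by
    intro z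
    rw [hc_re_fderiv (hd z), hc_re_fderiv (hd z), hc_im_fderiv (hd z), hc_im_fderiv (hd z),
      ← normSq_eq_norm_sq, normSq_apply]
    simp
    linear_combination ((fderiv ℝ h z I).re ^ 2 + (fderiv ℝ h z I).im ^ 2) * hc1
  have ip : Integrable (fun z => p z ^ 2) :=
    (hp.continuous.pow 2).integrable_of_hasCompactSupport
      (hc_sq hcp)
  have iq : Integrable (fun z => q z ^ 2) :=
    (hq.continuous.pow 2).integrable_of_hasCompactSupport
      (hc_sq hcq)
  simp_rw [e0, e1]
  have ipx := hI hp hcp hp 1 1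
  have ipy := hI hp hcp hp I I
  have iqx := hI hq hcq hq 1 1
  have iqy := hI hq hcq hq I I
  have im1 := hI hp hcp hq I 1
  have im2 := hI hq hcq hp I 1
  simp only [← sq] at ipx ipy iqx iqy
  have j1 : Integrable (fun z => (fderiv ℝ p z 1) ^ 2 + (fderiv ℝ q z 1) ^ 2) := ipx.add iqx
  have j2 : Integrable (fun z => (fderiv ℝ p z I) ^ 2 + (fderiv ℝ q z I) ^ 2) := ipy.add iqy
  have j3 : Integrable (fun z => (fderiv ℝ p z 1) ^ 2 + (fderiv ℝ q z 1) ^ 2 +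
      ((fderiv ℝ p z I) ^ 2 + (fderiv ℝ q z I) ^ 2)) := j1.add j2
  have j4 : Integrable (fun z => 2 * c *
      (fderiv ℝ p z I * fderiv ℝ q z 1 - fderiv ℝ q z I * fderiv ℝ p z 1)) :=
    (im1.sub im2).const_mul _
  rw [integral_add ip iq, integral_add j3 j4,
    integral_add j1 j2, integral_add ipx iqx, integral_const_mul,
    integral_sub im1 im2, N, sub_self, mul_zero, add_zero]
  have : 0 ≤ ∫ z, ((fderiv ℝ p z I) ^ 2 + (fderiv ℝ q z I) ^ 2) :=
    integral_nonneg (fun z => by positivity)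
  nlinarith [mul_nonneg (sq_nonneg ε) this]

end Carleman

section Carleman2
open MeasureTheory Filter Topology

/-- Laplacian -/
noncomputable def hcLap (w : ℂ → ℂ) (z : ℂ) : ℂ :=
  fderiv ℝ (fun z => fderiv ℝ w z 1) z 1 + fderiv ℝ (fun z => fderiv ℝ w z I) z I

lemma hc_fderiv_apply_contDiff {w : ℂ → ℂ} (hw : ContDiff ℝ 2 w) (v : ℂ) :
    ContDiff ℝ 1 (fun z => fderiv ℝ w z v) :=
  (hw.fderiv_right (m := 1) (by norm_num)).clm_apply contDiff_const

lemma hc_symm {w : ℂ → ℂ} {z : ℂ} (hw : ContDiffAt ℝ 2 w z) (a b : ℂ) :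
    fderiv ℝ (fun z => fderiv ℝ w z a) z b = fderiv ℝ (fun z => fderiv ℝ w z b) z a := by
  have h := hw.isSymmSndFDerivAt (by simp)
  have hd : DifferentiableAt ℝ (fderiv ℝ w) z :=
    (hw.fderiv_right (m := 1) (by norm_num)).differentiableAt (by norm_num)
  have e : ∀ a b, fderiv ℝ (fun z => fderiv ℝ w z a) z b = fderiv ℝ (fderiv ℝ w) z b a := by
    intro a b
    have := (hd.hasFDerivAt.clm_apply (hasFDerivAt_const a z)).fderiv
    rw [this]; simp
  rw [e, e]; exact h.eq b a

lemma hc_carleman {w : ℂ → ℂ} (hw : ContDiff ℝ 2 w) (hc : HasCompactSupport w)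
    {ε : ℝ} (hs : ∀ z, w z ≠ 0 → |z.re| ≤ ε) {G : ℂ → ℂ} (hG : Differentiable ℂ G) :
    ∫ z, ‖exp (G z) * w z‖ ^ 2 ≤ 16 * ε ^ 4 * ∫ z, ‖exp (G z) * hcLap w z‖ ^ 2 := by
  set E : ℂ → ℂ := fun z => exp (G z) with hE
  have hEd : Differentiable ℂ E := hG.cexp
  have hE1 : ContDiff ℝ 2 E := (hEd.contDiff (n := 2)).restrict_scalars ℝ
  have hEf : ∀ z, HasFDerivAt E ((ContinuousLinearMap.toSpanSingleton ℂ (deriv E z)).restrictScalars ℝ) z := by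
    intro z
    exact (hEd z).hasDerivAt.hasFDerivAt.restrictScalars ℝ
  -- first step
  set f : ℂ → ℂ := fun z => fderiv ℝ w z 1 + (-1 : ℝ) * I * fderiv ℝ w z I with hf
  have hf1 : ContDiff ℝ 1 f := (hc_fderiv_apply_contDiff hw 1).add
    (contDiff_const.mul (hc_fderiv_apply_contDiff hw I))
  have hts : ∀ z ∈ tsupport w, |z.re| ≤ ε := by
    intro z hz
    have : tsupport w ⊆ {z : ℂ | |z.re| ≤ ε} :=
      closure_minimal (fun z hz => hs z hz) (isClosed_le (continuous_re.abs) continuous_const)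
    exact this hz
  have hfz : ∀ z, z ∉ tsupport w → f z = 0 := by
    intro z hz
    have h0 : fderiv ℝ w z = 0 := by
      by_contra hne
      exact hz (support_fderiv_subset ℝ hne)
    simp [hf, h0]
  have hfc : HasCompactSupport f := HasCompactSupport.intro hc hfz
  have S1 := hc_dbar (h := fun z => E z * f z) ((hE1.of_le (by norm_num)).mul hf1) hfc.mul_left
    (ε := ε) (fun z hz => hts z (by
      by_contra h; exact hz (by simp [hfz z h]))) (c := 1) (by norm_num)
  have S2 := hc_dbar (h := fun z => (starRingEnd ℂ) (E z) * w z)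
    (((conjCLE.contDiff.comp hE1).mul hw).of_le (by norm_num)) hc.mul_left
    (ε := ε) (fun z hz => hs z (by
      intro h; exact hz (by simp [h]))) (c := -1) (by norm_num)
  have e1 : ∀ z, fderiv ℝ (fun z => E z * f z) z 1 + (1:ℝ) * I * fderiv ℝ (fun z => E z * f z) z I
      = E z * hcLap w z := by
    intro z
    have hw1 := (hc_fderiv_apply_contDiff hw 1).differentiable (by norm_num) z
    have hwI := (hc_fderiv_apply_contDiff hw I).differentiable (by norm_num) z
    have h1 : HasFDerivAt f _ z := hw1.hasFDerivAt.add (hwI.hasFDerivAt.const_mul ((-1 : ℝ) * I))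
    have h2 := ((hEf z).mul h1).fderiv
    have h3 := hc_symm (hw.contDiffAt (x := z)) 1 I
    rw [show (fun z => E z * f z) = E * f from rfl, h2]
    simp [hcLap]
    rw [h3]
    ring_nf
    simp
  have e2 : ∀ z, fderiv ℝ (fun z => (starRingEnd ℂ) (E z) * w z) z 1
      + (-1:ℝ) * I * fderiv ℝ (fun z => (starRingEnd ℂ) (E z) * w z) z I
      = (starRingEnd ℂ) (E z) * f z := by
    intro z
    have h1 : HasFDerivAt (fun z => (starRingEnd ℂ) (E z)) _ z :=
      conjCLE.toContinuousLinearMap.hasFDerivAt.comp z (hEf z)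
    have h2 := (h1.mul (hw.differentiable (by norm_num) z).hasFDerivAt).fderiv
    rw [show (fun z => (starRingEnd ℂ) (E z) * w z) = (fun z => (starRingEnd ℂ) (E z)) * w from rfl, h2]
    simp [hf]
    ring_nf
    simp
  simp_rw [e1] at S1
  simp_rw [e2] at S2
  simp only [norm_mul, RCLike.norm_conj] at S1 S2 ⊢
  calc _ ≤ _ := S2
    _ ≤ 4 * ε ^ 2 * (4 * ε ^ 2 * ∫ z, (‖E z‖ * ‖hcLap w z‖) ^ 2) := by gcongr
    _ = _ := by ring

end Carleman2

section Unique
open MeasureTheory Filter Topology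

lemma hc_lap_congr {f g : ℂ → ℂ} {z : ℂ} (h : f =ᶠ[𝓝 z] g) : hcLap f z = hcLap g z := by
  unfold hcLap
  have : ∀ v, (fun z => fderiv ℝ f z v) =ᶠ[𝓝 z] (fun z => fderiv ℝ g z v) := by
    intro v
    filter_upwards [h.fderiv (𝕜 := ℝ)] with x hx
    rw [hx]
  rw [(this 1).fderiv_eq, (this I).fderiv_eq]

lemma hc_lap_zero (z : ℂ) : hcLap (fun _ => 0) z = 0 := by
  simp [hcLap]

lemma hc_rect_open (ε B : ℝ) : IsOpen {z : ℂ | |z.re| < ε ∧ |z.im| < B} :=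
  (isOpen_lt continuous_re.abs continuous_const).inter
    (isOpen_lt continuous_im.abs continuous_const)

lemma hc_vanish {lam ε B : ℝ} (hε : 0 < ε) (hsmall : 64 * ε ^ 4 * lam ^ 4 ≤ 1)
    {W : ℂ → ℂ} (hW : ContDiffOn ℝ 2 W {z : ℂ | |z.re| < ε ∧ |z.im| < B})
    (heq : ∀ z : ℂ, |z.re| < ε → |z.im| < B → hcLap W z + (lam:ℂ) ^ 2 * W z = 0)
    (h0 : ∀ z : ℂ, z.im ≤ 0 → W z = 0) {y : ℝ} (hy : 0 < y) (hyB : y < B) :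
    W (y * I) = 0 := by
  obtain ⟨B1, hyB1, hB1⟩ := exists_between hyB
  obtain ⟨B2, hB12, hB2⟩ := exists_between hB1
  have hB1pos : 0 < B1 := hy.trans hyB1
  let a : ContDiffBump (0:ℝ) := ⟨ε / 2, 3 * ε / 4, by positivity, by linarith⟩
  let b : ContDiffBump (0:ℝ) := ⟨B1, B2, hB1pos, hB12⟩
  set χ : ℂ → ℝ := fun z => a z.re * b z.im with hχ
  have hχd : ContDiff ℝ 2 χ := (a.contDiff.comp reCLM.contDiff).mul (b.contDiff.comp imCLM.contDiff)
  have hχ0 : ∀ z, χ z ≠ 0 → |z.re| < 3 * ε / 4 ∧ |z.im| < B2 := by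
    intro z hz
    constructor
    · by_contra h
      apply hz
      have : a z.re = 0 := a.zero_of_le_dist (by simpa [a] using h)
      simp [hχ, this]
    · by_contra h
      apply hz
      have : b z.im = 0 := b.zero_of_le_dist (by simpa [b] using h)
      simp [hχ, this]
  have hχ1 : ∀ z, |z.re| < ε / 2 → |z.im| < B1 → χ z = 1 := by
    intro z h1 h2
    have e1 : a z.re = 1 := a.one_of_mem_closedBall (by simpa [a] using h1.le)
    have e2 : b z.im = 1 := b.one_of_mem_closedBall (by simpa [b] using h2.le)
    simp [hχ, e1, e2]
  set V : ℂ → ℂ := fun z => (χ z : ℂ) * W z with hV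
  have hV0 : ∀ z, V z ≠ 0 → |z.re| < 3 * ε / 4 ∧ |z.im| < B2 := by
    intro z hz
    apply hχ0 z
    intro h; apply hz; simp [hV, h]
  set C : Set ℂ := {z : ℂ | |z.re| ≤ 3 * ε / 4 ∧ |z.im| ≤ B2} with hC
  have hCclosed : IsClosed C := (isClosed_le continuous_re.abs continuous_const).inter
    (isClosed_le continuous_im.abs continuous_const)
  have hCc : IsCompact C := by
    apply Metric.isCompact_of_isClosed_isBounded hCclosed
    apply (Metric.isBounded_closedBall (x := (0:ℂ)) (r := 3 * ε / 4 + B2)).subset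
    intro z hz
    rw [mem_closedBall_zero_iff]
    exact (norm_le_abs_re_add_abs_im z).trans (add_le_add hz.1 hz.2)
  have hVc : HasCompactSupport V := HasCompactSupport.intro hCc (fun z hz => by
    by_contra h
    exact hz ⟨(hV0 z h).1.le, (hV0 z h).2.le⟩)
  have hVd : ContDiff ℝ 2 V := by
    rw [contDiff_iff_contDiffAt]
    intro z
    by_cases hz : z ∈ {z : ℂ | |z.re| < ε ∧ |z.im| < B}
    · exact (ofRealCLM.contDiff.comp hχd).contDiffAt.mul
        (hW.contDiffAt ((hc_rect_open ε B).mem_nhds hz))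
    · have hzC : z ∈ Cᶜ := by
        intro h; apply hz
        exact ⟨h.1.trans_lt (by linarith), h.2.trans_lt hB2⟩
      have : V =ᶠ[𝓝 z] fun _ => 0 := by
        filter_upwards [hCclosed.isOpen_compl.mem_nhds hzC] with x hx
        by_contra h
        exact hx ⟨(hV0 x h).1.le, (hV0 x h).2.le⟩
      exact contDiffAt_const.congr_of_eventuallyEq this
  have hLc : Continuous (hcLap V) := by
    unfold hcLap
    have := fun v => ((hc_fderiv_apply_contDiff hVd v).continuous_fderiv (by norm_num)).clm_apply
      (continuous_const (y := v))
    exact (this 1).add (this I)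
  set rem : ℂ → ℂ := fun z => hcLap V z + (lam:ℂ) ^ 2 * V z with hrem
  have hremc : Continuous rem := hLc.add (continuous_const.mul hVd.continuous)
  have hrem0 : ∀ z, rem z ≠ 0 → z ∈ C := by
    intro z hz
    by_contra hzC
    have : V =ᶠ[𝓝 z] fun _ => 0 := by
      filter_upwards [hCclosed.isOpen_compl.mem_nhds hzC] with x hx
      by_contra h
      exact hx ⟨(hV0 x h).1.le, (hV0 x h).2.le⟩
    apply hz
    simp only [hrem]
    rw [hc_lap_congr this, hc_lap_zero, this.self_of_nhds]; simp
  have hremcs : HasCompactSupport rem := HasCompactSupport.intro hCc (fun z hz => by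
    by_contra h; exact hz (hrem0 z h))
  -- where the remainder lives
  have hrem1 : ∀ z, rem z ≠ 0 → 0 ≤ z.im ∧ (ε / 2 ≤ |z.re| ∨ B1 ≤ z.im) := by
    intro z hz
    have him : 0 ≤ z.im := by
      by_contra h
      push Not at h
      have : V =ᶠ[𝓝 z] fun _ => 0 := by
        filter_upwards [(isOpen_lt continuous_im continuous_const).mem_nhds h] with x hx
        have : W x = 0 := h0 x (le_of_lt hx)
        simp [hV, this]
      apply hz
      simp only [hrem]
      rw [hc_lap_congr this, hc_lap_zero, this.self_of_nhds]; simp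
    refine ⟨him, ?_⟩
    by_contra h
    push Not at h
    have h2 : |z.im| < B1 := by rw [abs_of_nonneg him]; exact h.2
    have : V =ᶠ[𝓝 z] W := by
      filter_upwards [(hc_rect_open (ε/2) B1).mem_nhds ⟨h.1, h2⟩] with x hx
      simp [hV, hχ1 x hx.1 hx.2]
    apply hz
    simp only [hrem]
    rw [hc_lap_congr this, this.self_of_nhds]
    exact heq z (h.1.trans (by linarith)) (h2.trans hB1)
  -- the weight
  set k : ℝ := Real.pi / ε with hk
  have hkpos : 0 < k := div_pos Real.pi_pos hε
  set s : ℝ := Real.exp (-(k * B1)) with hs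
  set ψ : ℂ → ℝ := fun z => Real.exp (-(k * z.im)) * Real.cos (k * z.re) - s with hψ
  have hψc : Continuous ψ := by fun_prop
  have hGre : ∀ (N : ℕ) (z : ℂ), ((N : ℂ) * (exp (k * I * z) - s)).re = N * ψ z := by
    intro N z
    have h1 : (exp (k * I * z)).re = Real.exp (-(k * z.im)) * Real.cos (k * z.re) := by
      rw [exp_re]; simp
    rw [← ofReal_natCast, re_ofReal_mul, sub_re, h1, ofReal_re]
  have hψrem : ∀ z, rem z ≠ 0 → ψ z ≤ 0 := by
    intro z hz
    obtain ⟨h1, h2⟩ := hrem1 z hz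
    have h3 := hrem0 z hz
    simp only [hψ]
    by_cases h4 : B1 ≤ z.im
    · have : Real.exp (-(k * z.im)) ≤ s := by
        apply Real.exp_le_exp.mpr
        nlinarith
      have h5 := Real.cos_le_one (k * z.re)
      have h6 := Real.exp_pos (-(k * z.im))
      nlinarith
    · have h5 : ε / 2 ≤ |z.re| := h2.resolve_right h4
      have h6 : |z.re| ≤ ε := h3.1.trans (by linarith)
      have h7 : Real.cos (k * z.re) ≤ 0 := by
        rw [← Real.cos_abs, abs_mul, abs_of_pos hkpos]
        have e1 : k * (ε / 2) = Real.pi / 2 := by rw [hk]; field_simp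
        have e2 : k * ε = Real.pi := by rw [hk]; field_simp
        apply Real.cos_nonpos_of_pi_div_two_le_of_le
        · rw [← e1]; gcongr
        · have : k * |z.re| ≤ k * ε := by gcongr
          linarith [Real.pi_pos]
      have h8 := Real.exp_pos (-(k * z.im))
      have h9 : 0 < s := Real.exp_pos _
      nlinarith
  -- main estimate
  have main : ∀ N : ℕ, ∫ z, Real.exp (N * ψ z) ^ 2 * ‖V z‖ ^ 2 ≤ 64 * ε ^ 4 * ∫ z, ‖rem z‖ ^ 2 := by
    intro N
    have hC := hc_carleman hVd hVc (ε := ε) (fun z hz => by linarith [(hV0 z hz).1])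
      (G := fun z => (N : ℂ) * (exp (k * I * z) - s)) (by fun_prop)
    simp only [norm_mul, norm_exp, hGre, mul_pow] at hC
    have iV : Integrable (fun z => Real.exp (N * ψ z) ^ 2 * ‖V z‖ ^ 2) := by
      apply Continuous.integrable_of_hasCompactSupport
      · have := hVd.continuous
        fun_prop
      · exact (hc_sq hVc.norm).mul_left
    have irem : Integrable (fun z => ‖rem z‖ ^ 2) := hc_int hremc hremcs
    have hLcs : HasCompactSupport (hcLap V) := by
      have : hcLap V = fun z => rem z - (lam:ℂ) ^ 2 * V z := by ext z; simp [hrem]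
      rw [this]
      exact hremcs.sub hVc.mul_left
    have iL : Integrable (fun z => Real.exp (N * ψ z) ^ 2 * ‖hcLap V z‖ ^ 2) := by
      apply Continuous.integrable_of_hasCompactSupport
      · fun_prop
      · exact (hc_sq hLcs.norm).mul_left
    have le : ∫ z, Real.exp (N * ψ z) ^ 2 * ‖hcLap V z‖ ^ 2 ≤
        ∫ z, (2 * lam ^ 4 * (Real.exp (N * ψ z) ^ 2 * ‖V z‖ ^ 2) + 2 * ‖rem z‖ ^ 2) := by
      apply integral_mono iL ((iV.const_mul _).add (irem.const_mul _))
      intro z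
      show Real.exp (N * ψ z) ^ 2 * ‖hcLap V z‖ ^ 2 ≤
        2 * lam ^ 4 * (Real.exp (N * ψ z) ^ 2 * ‖V z‖ ^ 2) + 2 * ‖rem z‖ ^ 2
      have h1 : ‖hcLap V z‖ ≤ ‖rem z‖ + lam ^ 2 * ‖V z‖ := by
        have : hcLap V z = rem z - (lam:ℂ) ^ 2 * V z := by simp [hrem]
        rw [this]
        refine (norm_sub_le _ _).trans ?_
        simp
      have h2 : ‖hcLap V z‖ ^ 2 ≤ 2 * ‖rem z‖ ^ 2 + 2 * lam ^ 4 * ‖V z‖ ^ 2 := by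
        have := pow_le_pow_left₀ (norm_nonneg _) h1 2
        nlinarith [sq_nonneg (‖rem z‖ - lam ^ 2 * ‖V z‖)]
      have h3 : Real.exp (N * ψ z) ^ 2 * ‖rem z‖ ^ 2 ≤ ‖rem z‖ ^ 2 := by
        by_cases hz : rem z = 0
        · simp [hz]
        · have h4 : Real.exp (N * ψ z) ≤ 1 := by
            rw [Real.exp_le_one_iff]
            exact mul_nonpos_of_nonneg_of_nonpos (Nat.cast_nonneg _) (hψrem z hz)
          have h5 : Real.exp (N * ψ z) ^ 2 ≤ 1 := pow_le_one₀ (Real.exp_pos _).le h4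
          nlinarith [sq_nonneg ‖rem z‖]
      nlinarith [mul_le_mul_of_nonneg_left h2 (sq_nonneg (Real.exp (N * ψ z)))]
    rw [integral_add (iV.const_mul _) (irem.const_mul _), integral_const_mul,
      integral_const_mul] at le
    have hnn : 0 ≤ ∫ z, Real.exp (N * ψ z) ^ 2 * ‖V z‖ ^ 2 := integral_nonneg (fun z => by positivity)
    have hε4 : 0 ≤ 16 * ε ^ 4 := by positivity
    have := mul_le_mul_of_nonneg_left le hε4
    nlinarith [mul_le_mul_of_nonneg_right hsmall hnn]
  by_contra hne
  have hyχ : χ (y * I) = 1 := hχ1 _ (by simp; positivity) (by simp [abs_of_pos hy]; exact hyB1)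
  have hVne : V (y * I) ≠ 0 := by simpa [hV, hyχ] using hne
  have hψy : 0 < ψ (y * I) := by
    simp [hψ, hs]
    gcongr
  have hfc : Continuous (fun z => max 0 (ψ z) * ‖V z‖ ^ 2) := by
    have := hVd.continuous
    fun_prop
  have hfcs : HasCompactSupport (fun z => max 0 (ψ z) * ‖V z‖ ^ 2) := (hc_sq hVc.norm).mul_left
  have hpos : 0 < ∫ z, max 0 (ψ z) * ‖V z‖ ^ 2 := by
    apply hfc.integral_pos_of_hasCompactSupport_nonneg_nonzero hfcs (x := y * I)
    · intro z; simp only [Pi.zero_apply]; positivity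
    · rw [max_eq_right hψy.le]
      exact mul_ne_zero hψy.ne' (pow_ne_zero 2 (norm_ne_zero_iff.mpr hVne))
  have hup : ∀ N : ℕ, (N : ℝ) * ∫ z, max 0 (ψ z) * ‖V z‖ ^ 2 ≤ 64 * ε ^ 4 * ∫ z, ‖rem z‖ ^ 2 := by
    intro N
    refine le_trans ?_ (main N)
    rw [← integral_const_mul]
    apply integral_mono ((hfc.integrable_of_hasCompactSupport hfcs).const_mul _)
    · apply Continuous.integrable_of_hasCompactSupport
      · have := hVd.continuous
        fun_prop
      · exact (hc_sq hVc.norm).mul_left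
    · intro z
      show (N : ℝ) * (max 0 (ψ z) * ‖V z‖ ^ 2) ≤ Real.exp (N * ψ z) ^ 2 * ‖V z‖ ^ 2
      rw [← mul_assoc]
      gcongr
      rw [← Real.exp_nat_mul]
      have h1 := Real.add_one_le_exp ((2 : ℕ) * (N * ψ z))
      have h2 := Real.exp_pos ((2 : ℕ) * (N * ψ z))
      have h3 : (0 : ℝ) ≤ N := Nat.cast_nonneg N
      rcases le_total (ψ z) 0 with h | h
      · rw [max_eq_left h]; simpa using h2.le
      · rw [max_eq_right h]
        push_cast at h1 ⊢
        nlinarith [mul_nonneg h3 h]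
  obtain ⟨N, hN⟩ := exists_nat_gt ((64 * ε ^ 4 * ∫ z, ‖rem z‖ ^ 2) / ∫ z, max 0 (ψ z) * ‖V z‖ ^ 2)
  rw [div_lt_iff₀ hpos] at hN
  exact absurd (hup N) (not_le.mpr hN)

end Unique

section Glue
open MeasureTheory Filter Topology

/-- extension by zero from the upper half plane -/
noncomputable def hcGlue {F : Type} [Zero F] (f : ℂ → F) (z : ℂ) : F :=
  open Classical in if z.im ≤ 0 then 0 else f z

lemma hcGlue_norm {F : Type} [NormedAddCommGroup F] (f : ℂ → F) (z : ℂ) :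
    ‖hcGlue f z‖ ≤ ‖f z‖ := by
  unfold hcGlue; split_ifs <;> simp

lemma hcGlue_pos {F : Type} [NormedAddCommGroup F] (f : ℂ → F) {z : ℂ} (h : 0 < z.im) :
    hcGlue f =ᶠ[𝓝 z] f := by
  filter_upwards [(isOpen_lt continuous_const continuous_im).mem_nhds h] with x hx
  simp [hcGlue, not_le.mpr hx]

lemma hcGlue_neg {F : Type} [NormedAddCommGroup F] (f : ℂ → F) {z : ℂ} (h : z.im < 0) :
    hcGlue f =ᶠ[𝓝 z] fun _ => 0 := by
  filter_upwards [(isOpen_lt continuous_im continuous_const).mem_nhds h] with x hx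
  have : x.im ≤ 0 := le_of_lt hx
  simp [hcGlue, this]

lemma hcGlue_contAt {F : Type} [NormedAddCommGroup F] {f : ℂ → F} {z : ℂ}
    (hf : ContinuousAt f z) (h0 : z.im = 0 → f z = 0) : ContinuousAt (hcGlue f) z := by
  rcases lt_trichotomy z.im 0 with h | h | h
  · exact continuousAt_const.congr (hcGlue_neg f h).symm
  · have e : hcGlue f z = 0 := by simp [hcGlue, h]
    unfold ContinuousAt
    rw [e]
    apply squeeze_zero_norm (fun x => hcGlue_norm f x)
    have := hf.norm
    rw [ContinuousAt, h0 h, norm_zero] at this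
    exact this
  · exact hf.congr (hcGlue_pos f h).symm

lemma hcGlue_deriv {F : Type} [NormedAddCommGroup F] [NormedSpace ℝ F] {f : ℂ → F} {z : ℂ}
    (hf : DifferentiableAt ℝ f z) (h0 : z.im = 0 → f z = 0) (h1 : z.im = 0 → fderiv ℝ f z = 0) :
    HasFDerivAt (hcGlue f) (hcGlue (fderiv ℝ f) z) z := by
  rcases lt_trichotomy z.im 0 with h | h | h
  · rw [(hcGlue_neg _ h).self_of_nhds]
    exact (hasFDerivAt_const (0:F) z).congr_of_eventuallyEq (hcGlue_neg f h)
  · have e : hcGlue f z = 0 := by simp [hcGlue, h]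
    have e' : hcGlue (fderiv ℝ f) z = 0 := by simp [hcGlue, h]
    have := hf.hasFDerivAt
    rw [hasFDerivAt_iff_isLittleO, h0 h, h1 h] at this
    rw [hasFDerivAt_iff_isLittleO, e, e']
    simp only [sub_zero, zero_apply] at this ⊢
    exact (Asymptotics.IsBigO.of_bound 1 (Eventually.of_forall fun x => by
      simpa using hcGlue_norm f x)).trans_isLittleO this
  · rw [(hcGlue_pos _ h).self_of_nhds]
    exact hf.hasFDerivAt.congr_of_eventuallyEq (hcGlue_pos f h)

lemma hcGlue_contDiff {F : Type} [NormedAddCommGroup F] [NormedSpace ℝ F] {f : ℂ → F} {U : Set ℂ}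
    (hU : IsOpen U) (hf : ContDiffOn ℝ 1 f U) (h0 : ∀ z ∈ U, z.im = 0 → f z = 0)
    (h1 : ∀ z ∈ U, z.im = 0 → fderiv ℝ f z = 0) : ContDiffOn ℝ 1 (hcGlue f) U := by
  have hd : ∀ z ∈ U, DifferentiableAt ℝ f z := fun z hz =>
    (hf.differentiableOn (by norm_num)).differentiableAt (hU.mem_nhds hz)
  have hg := fun z hz => hcGlue_deriv (hd z hz) (h0 z hz) (h1 z hz)
  rw [show (1 : WithTop ℕ∞) = 0 + 1 from rfl, contDiffOn_succ_iff_fderiv_of_isOpen hU]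
  refine ⟨fun z hz => (hg z hz).differentiableAt.differentiableWithinAt, by simp, ?_⟩
  rw [contDiffOn_zero]
  have hc := hf.continuousOn_fderiv_of_isOpen hU (by norm_num)
  have : ContinuousOn (hcGlue (fderiv ℝ f)) U := fun z hz =>
    (hcGlue_contAt (hc.continuousAt (hU.mem_nhds hz)) (h1 z hz)).continuousWithinAt
  exact this.congr (fun z hz => (hg z hz).fderiv)

lemma hc_clm_ext {F : Type} [NormedAddCommGroup F] [NormedSpace ℝ F] {L : ℂ →L[ℝ] F}
    (h1 : L 1 = 0) (hI : L I = 0) : L = 0 := by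
  ext z
  have : z = z.re • (1:ℂ) + z.im • I := by simp [re_add_im]
  rw [this, map_add, map_smul, map_smul, h1, hI]; simp

/-- a differentiable function vanishing on the real axis has zero `x`-derivative there -/
lemma hc_axis {F : Type} [NormedAddCommGroup F] [NormedSpace ℝ F] {f : ℂ → F} {U : Set ℂ}
    (hU : IsOpen U) {z : ℂ} (hz : z ∈ U) (hf : DifferentiableAt ℝ f z)
    (h0 : ∀ z ∈ U, z.im = 0 → f z = 0) (hi : z.im = 0) : fderiv ℝ f z 1 = 0 := by
  rw [← hf.lineDeriv_eq_fderiv]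
  unfold lineDeriv
  have : (fun t : ℝ => f (z + t • (1:ℂ))) =ᶠ[𝓝 0] fun _ => 0 := by
    have hc : ContinuousAt (fun t : ℝ => z + t • (1:ℂ)) 0 := by fun_prop
    have := hc.preimage_mem_nhds (t := U) (by simpa using hU.mem_nhds hz)
    filter_upwards [this] with t ht
    exact h0 _ ht (by simp [hi])
  rw [this.deriv_eq]; simp

lemma hc_unique_up {lam ε B : ℝ} (hε : 0 < ε)
    {w : ℂ → ℂ} (hw : ContDiffOn ℝ 2 w {z : ℂ | |z.re| < ε ∧ |z.im| < B})
    (heq : ∀ z : ℂ, |z.re| < ε → |z.im| < B → hcLap w z + (lam:ℂ) ^ 2 * w z = 0)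
    (h0 : ∀ x : ℝ, |x| < ε → w x = 0) (h1 : ∀ x : ℝ, |x| < ε → fderiv ℝ w x I = 0)
    {y : ℝ} (hy : 0 < y) (hyB : y < B) :
    w (y * I) = 0 := by
  set U : Set ℂ := {z : ℂ | |z.re| < ε ∧ |z.im| < B} with hUdef
  have hU : IsOpen U := hc_rect_open ε B
  have hwa : ∀ z ∈ U, ContDiffAt ℝ 2 w z := fun z hz => hw.contDiffAt (hU.mem_nhds hz)
  have hwd : ∀ z ∈ U, DifferentiableAt ℝ w z := fun z hz => (hwa z hz).differentiableAt (by norm_num)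
  have hreal : ∀ z : ℂ, z.im = 0 → z = (z.re : ℂ) := fun z hz => by apply Complex.ext <;> simp [hz]
  have h0' : ∀ z ∈ U, z.im = 0 → w z = 0 := by
    intro z hz hi; rw [hreal z hi]; exact h0 _ hz.1
  have h1' : ∀ z ∈ U, z.im = 0 → fderiv ℝ w z = 0 := by
    intro z hz hi
    apply hc_clm_ext
    · exact hc_axis hU hz (hwd z hz) h0' hi
    · rw [hreal z hi]; exact h1 _ hz.1
  have hDw : ContDiffOn ℝ 1 (fderiv ℝ w) U := hw.fderiv_of_isOpen hU (by norm_num)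
  have hDd : ∀ z ∈ U, DifferentiableAt ℝ (fderiv ℝ w) z := fun z hz =>
    (hDw.contDiffAt (hU.mem_nhds hz)).differentiableAt (by norm_num)
  have e : ∀ z ∈ U, ∀ a b, fderiv ℝ (fun z => fderiv ℝ w z a) z b = fderiv ℝ (fderiv ℝ w) z b a := by
    intro z hz a b
    have := ((hDd z hz).hasFDerivAt.clm_apply (hasFDerivAt_const a z)).fderiv
    rw [this]; simp
  have h2' : ∀ z ∈ U, z.im = 0 → fderiv ℝ (fderiv ℝ w) z = 0 := by
    intro z hz hi
    have hx : fderiv ℝ (fderiv ℝ w) z 1 = 0 := hc_axis hU hz (hDd z hz) h1' hi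
    apply hc_clm_ext hx
    apply hc_clm_ext
    · have := hc_symm (hwa z hz) 1 I
      rw [e z hz, e z hz, hx] at this
      simpa using this
    · have := heq z hz.1 hz.2
      unfold hcLap at this
      rw [h0' z hz hi, e z hz, e z hz, hx] at this
      simpa using this
  have hW1 := hcGlue_contDiff hU (hw.of_le (by norm_num)) h0' h1'
  have hWD := hcGlue_contDiff hU hDw h1' h2'
  have hW : ContDiffOn ℝ 2 (hcGlue w) U := by
    rw [show (2 : WithTop ℕ∞) = 1 + 1 from by norm_num, contDiffOn_succ_iff_fderiv_of_isOpen hU]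
    refine ⟨hW1.differentiableOn (by norm_num), by simp, ?_⟩
    exact hWD.congr (fun z hz => (hcGlue_deriv (hwd z hz) (h0' z hz) (h1' z hz)).fderiv)
  have hWeq : ∀ z ∈ U, hcLap (hcGlue w) z + (lam:ℂ) ^ 2 * hcGlue w z = 0 := by
    have hpos : ∀ z ∈ U, z.im ≠ 0 → hcLap (hcGlue w) z + (lam:ℂ) ^ 2 * hcGlue w z = 0 := by
      intro z hz hne
      rcases lt_or_gt_of_ne hne with h | h
      · rw [hc_lap_congr (hcGlue_neg w h), hc_lap_zero, (hcGlue_neg w h).self_of_nhds]; simp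
      · rw [hc_lap_congr (hcGlue_pos w h), (hcGlue_pos w h).self_of_nhds]; exact heq z hz.1 hz.2
    intro z hz
    by_cases hi : z.im = 0
    · have hg1 : ∀ v, (fun z => fderiv ℝ (hcGlue w) z v) =ᶠ[𝓝 z] fun z => hcGlue (fderiv ℝ w) z v := by
        intro v
        filter_upwards [hU.mem_nhds hz] with x hx
        rw [(hcGlue_deriv (hwd x hx) (h0' x hx) (h1' x hx)).fderiv]
      have hg2 := hcGlue_deriv (hDd z hz) (h1' z hz) (h2' z hz)
      have e0 : hcGlue (fderiv ℝ (fderiv ℝ w)) z = 0 := by simp [hcGlue, hi]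
      rw [e0] at hg2
      have : ∀ v, fderiv ℝ (fun z => fderiv ℝ (hcGlue w) z v) z = 0 := by
        intro v
        rw [(hg1 v).fderiv_eq]
        have := (hg2.clm_apply (hasFDerivAt_const v z)).fderiv
        rw [this]; simp
      unfold hcLap
      rw [this, this]
      simp [hcGlue, hi]
    · exact hpos z hz hi
  -- shrink
  set ε' := min ε (1 / (4 * (1 + |lam|))) with hε'
  have hl : 0 < 4 * (1 + |lam|) := by positivity
  have hε'pos : 0 < ε' := lt_min hε (by positivity)
  have hle : ε' ≤ ε := min_le_left _ _
  have hsm : ε' * |lam| ≤ 1 / 4 := by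
    have : ε' ≤ 1 / (4 * (1 + |lam|)) := min_le_right _ _
    rw [le_div_iff₀ hl] at this
    nlinarith [abs_nonneg lam]
  have hsmall : 64 * ε' ^ 4 * lam ^ 4 ≤ 1 := by
    have h4 := pow_le_pow_left₀ (by positivity) hsm 4
    rw [mul_pow, Even.pow_abs (by decide)] at h4
    nlinarith
  have := hc_vanish hε'pos hsmall
    (hW.mono (fun z hz => ⟨hz.1.trans_le hle, hz.2⟩))
    (fun z h1 h2 => hWeq z ⟨h1.trans_le hle, h2⟩) (fun z hz => by simp [hcGlue, hz]) hy hyB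
  simpa [hcGlue, not_le.mpr hy] using this

lemma hc_unique {lam ε B a : ℝ} (hε : 0 < ε)
    {w : ℂ → ℂ} (hw : ContDiffOn ℝ 2 w {z : ℂ | |z.re - a| < ε ∧ |z.im| < B})
    (heq : ∀ z : ℂ, |z.re - a| < ε → |z.im| < B → hcLap w z + (lam:ℂ) ^ 2 * w z = 0)
    (h0 : ∀ x : ℝ, |x - a| < ε → w x = 0) (h1 : ∀ x : ℝ, |x - a| < ε → fderiv ℝ w x I = 0)
    {y : ℝ} (hyB : |y| < B) :
    w (a + y * I) = 0 := by
  have key : ∀ c : ℝ, c ^ 2 = 1 → ∀ t : ℝ, 0 < t → t < B → w (a + c * (t * I)) = 0 := by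
    intro c hc t ht htB
    have hca : |c| = 1 := by
      have : |c| ^ 2 = 1 := by rw [sq_abs]; exact hc
      nlinarith [abs_nonneg c]
    have hcne : c ≠ 0 := by rintro rfl; norm_num at hc
    have hA : ∀ z : ℂ, (a + c * z : ℂ).re = a + c * z.re := by intro z; simp
    have hA' : ∀ z : ℂ, (a + c * z : ℂ).im = c * z.im := by intro z; simp
    have hm : ∀ z : ℂ, |z.re| < ε → |(a + c * z : ℂ).re - a| < ε := by
      intro z hz; rw [hA]; simpa [abs_mul, hca] using hz
    have hm' : ∀ z : ℂ, |z.im| < B → |(a + c * z : ℂ).im| < B := by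
      intro z hz; rw [hA']; simpa [abs_mul, hca] using hz
    have hfd : ∀ (g : ℂ → ℂ) (z v : ℂ), fderiv ℝ (fun z => g (a + c * z)) z v
        = c * fderiv ℝ g (a + c * z) v := by
      intro g z v
      have e1 : (fun z => g (a + c * z)) = fun z => (fun x => g (a + x)) (c • z) := by
        ext z; simp
      rw [e1, fderiv_comp_smul (f := fun x => g (a + x)) (c := c)]
      simp [fderiv_comp_add_left]
    have hLap : ∀ z, hcLap (fun z => w (a + c * z)) z = hcLap w (a + c * z) := by
      intro z
      unfold hcLap
      have : ∀ v, fderiv ℝ (fun z => fderiv ℝ (fun z => w (a + c * z)) z v) z v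
          = fderiv ℝ (fun z => fderiv ℝ w z v) (a + c * z) v := by
        intro v
        have e2 : (fun z => fderiv ℝ (fun z => w (a + c * z)) z v)
          = fun z => (fun x => c * fderiv ℝ w x v) (a + c * z) := by
          ext z; exact hfd w z v
        rw [e2, hfd (fun x => c * fderiv ℝ w x v)]
        have e3 : (fun x => (c : ℂ) * fderiv ℝ w x v) = c • fun x => fderiv ℝ w x v := by
          ext x; simp
        rw [e3, fderiv_const_smul_field]
        simp only [smul_apply, Pi.smul_apply, real_smul]
        rw [← mul_assoc, ← sq]
        rw [show (c:ℂ) ^ 2 = 1 by exact_mod_cast hc, one_mul]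
      rw [this, this]
    apply hc_unique_up (lam := lam) (B := B) hε (w := fun z => w (a + c * z)) _ _ _ _ ht htB
    · apply hw.comp
      · exact (contDiff_const.add (contDiff_const.mul contDiff_id)).contDiffOn
      · intro z hz; exact ⟨hm z hz.1, hm' z hz.2⟩
    · intro z hz hz'
      rw [hLap]; exact heq _ (hm z hz) (hm' z hz')
    · intro x hx
      have := h0 (a + c * x) (by simpa [abs_mul, hca] using hx)
      simpa using this
    · intro x hx
      rw [hfd]
      have := h1 (a + c * x) (by simpa [abs_mul, hca] using hx)
      push_cast at this
      rw [this, mul_zero]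
  rcases lt_trichotomy y 0 with h | h | h
  · have := key (-1) (by norm_num) (-y) (by linarith) (by rw [abs_of_neg h] at hyB; exact hyB)
    simpa using this
  · have := h0 a (by simpa using hε)
    simpa [h] using this
  · have := key 1 (by norm_num) y h (by rw [abs_of_pos h] at hyB; exact hyB)
    simpa using this

end Glue

section Bessel
open Filter Topology

noncomputable def hcSer (c : ℕ → ℂ) (ζ : ℂ) : ℂ := ∑' n, c n * ζ ^ n

def hcBd (c : ℕ → ℂ) : Prop := ∃ C r : ℝ, 0 ≤ r ∧ ∀ n, ‖c n‖ ≤ C * (r ^ n / n.factorial)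

lemma hcBd_summable {c : ℕ → ℂ} (hc : hcBd c) (R : ℝ) (hR : 0 ≤ R) :
    Summable (fun n => ‖c n‖ * R ^ n) := by
  obtain ⟨C, r, hr, h⟩ := hc
  refine Summable.of_nonneg_of_le (fun n => by positivity) (fun n => ?_)
    ((Real.summable_pow_div_factorial (r * R)).mul_left C)
  calc ‖c n‖ * R ^ n ≤ C * (r ^ n / n.factorial) * R ^ n := by gcongr; exact h n
    _ = _ := by rw [mul_pow]; ring

lemma hcBd_shift {c : ℕ → ℂ} (hc : hcBd c) : hcBd (fun n => (n + 1) * c (n + 1)) := by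
  obtain ⟨C, r, hr, h⟩ := hc
  refine ⟨C * r, r, hr, fun n => ?_⟩
  have h1 : ‖((n : ℂ) + 1)‖ = n + 1 := by
    have : ((n : ℂ) + 1) = ((n + 1 : ℕ) : ℂ) := by push_cast; rfl
    rw [this, norm_natCast]; push_cast; rfl
  rw [norm_mul, h1]
  calc ((n : ℝ) + 1) * ‖c (n + 1)‖ ≤ (n + 1) * (C * (r ^ (n + 1) / (n + 1).factorial)) := by
        gcongr; exact h _
    _ = _ := by
      rw [Nat.factorial_succ]; push_cast
      have : (n.factorial : ℝ) ≠ 0 := by positivity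
      field_simp
      ring

lemma hcSer_hasDerivAt {c : ℕ → ℂ} (hc : hcBd c) (ζ : ℂ) :
    HasDerivAt (hcSer c) (hcSer (fun n => (n + 1) * c (n + 1)) ζ) ζ := by
  set R : ℝ := ‖ζ‖ + 1
  have hR : 0 ≤ R := by positivity
  have hsum : Summable (fun n : ℕ => ‖(n : ℂ) * c n‖ * R ^ (n - 1)) := by
    rw [← summable_nat_add_iff 1]
    have := hcBd_summable (hcBd_shift hc) R hR
    simpa using this
  have h := hasDerivAt_tsum_of_isPreconnected (g := fun n (z : ℂ) => c n * z ^ n)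
    (g' := fun n z => c n * (n * z ^ (n - 1))) hsum (t := Metric.ball (0:ℂ) R) Metric.isOpen_ball
    (convex_ball (0:ℂ) R).isPreconnected
    (fun n y _ => (hasDerivAt_pow n y).const_mul (c n))
    (fun n y hy => by
      have hy' : ‖y‖ ≤ R := by simpa using (mem_ball_zero_iff.mp hy).le
      rw [norm_mul, norm_mul, norm_mul, norm_pow]
      calc _ = ‖(n:ℂ)‖ * ‖c n‖ * ‖y‖ ^ (n - 1) := by ring
        _ ≤ _ := by gcongr)
    (y₀ := 0) (by simp [R]; positivity)
    (by
      apply summable_of_ne_finset_zero (s := {0})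
      intro n hn
      have : n ≠ 0 := by simpa using hn
      simp [this])
    (y := ζ) (by simp [R])
  have e : ∑' n, c n * (n * ζ ^ (n - 1)) = hcSer (fun n => (n + 1) * c (n + 1)) ζ := by
    have hs : Summable (fun n : ℕ => c n * (n * ζ ^ (n - 1))) := by
      refine Summable.of_norm_bounded hsum (fun n => ?_)
      rw [norm_mul, norm_mul, norm_mul, norm_pow]
      calc _ = ‖(n:ℂ)‖ * ‖c n‖ * ‖ζ‖ ^ (n - 1) := by ring
        _ ≤ _ := by gcongr; simp [R]
    rw [hs.tsum_eq_zero_add]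
    simp only [hcSer]
    simp
    congr 1; ext n; ring
  rw [e] at h
  exact h

noncomputable def hcCoef (lam : ℝ) (n : ℕ) : ℂ := (-(lam : ℂ) ^ 2 / 4) ^ n / ((n.factorial : ℂ)) ^ 2

lemma hc_bessel_eq (lam : ℝ) : besselKernel lam = hcSer (hcCoef lam) := rfl

lemma hcCoef_bd (lam : ℝ) : hcBd (hcCoef lam) := by
  refine ⟨1, lam ^ 2 / 4, by positivity, fun n => ?_⟩
  unfold hcCoef
  rw [norm_div, norm_pow, norm_pow, norm_natCast, norm_div, norm_neg, norm_pow]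
  simp
  have : (1:ℝ) ≤ n.factorial := by exact_mod_cast Nat.one_le_iff_ne_zero.mpr (Nat.factorial_ne_zero n)
  gcongr
  nlinarith

lemma hcCoef_bd' (lam : ℝ) : hcBd (fun n => n * hcCoef lam n) := by
  obtain ⟨C, r, hr, h⟩ := hcCoef_bd lam
  have hC : 0 ≤ C := by simpa using (norm_nonneg _).trans (h 0)
  refine ⟨C, 2 * r, by positivity, fun n => ?_⟩
  rw [norm_mul, norm_natCast]
  have h2 : (n : ℝ) ≤ 2 ^ n := by exact_mod_cast Nat.lt_two_pow_self.le
  calc (n:ℝ) * ‖hcCoef lam n‖ ≤ 2 ^ n * (C * (r ^ n / n.factorial)) := by gcongr; exact h n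
    _ = _ := by rw [mul_pow]; ring

lemma hc_bessel_diff (lam : ℝ) : Differentiable ℂ (besselKernel lam) := by
  rw [hc_bessel_eq]
  exact fun ζ => (hcSer_hasDerivAt (hcCoef_bd lam) ζ).differentiableAt

lemma hc_bessel_zero (lam : ℝ) : besselKernel lam 0 = 1 := by
  unfold besselKernel
  rw [tsum_eq_single 0]
  · simp
  · intro n hn; simp [hn]

lemma hc_bessel_ode (lam : ℝ) (ζ : ℂ) :
    ζ * deriv (deriv (besselKernel lam)) ζ + deriv (besselKernel lam) ζ
      + (lam:ℂ) ^ 2 / 4 * besselKernel lam ζ = 0 := by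
  have hK' : deriv (besselKernel lam) = hcSer (fun n => (n + 1) * hcCoef lam (n + 1)) := by
    ext z; rw [hc_bessel_eq]; exact (hcSer_hasDerivAt (hcCoef_bd lam) z).deriv
  have h1 : (fun z => z * deriv (besselKernel lam) z) = hcSer (fun n => n * hcCoef lam n) := by
    ext z
    rw [hK']
    simp only [hcSer]
    have hs : Summable (fun n : ℕ => (n : ℂ) * hcCoef lam n * z ^ n) := by
      apply Summable.of_norm
      simpa [norm_mul, norm_pow] using hcBd_summable (hcCoef_bd' lam) ‖z‖ (norm_nonneg _)
    rw [hs.tsum_eq_zero_add, ← tsum_mul_left]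
    simp
    congr 1; ext n; ring
  have h2 := (hcSer_hasDerivAt (hcCoef_bd' lam) ζ)
  rw [← h1] at h2
  have hd : DifferentiableAt ℂ (deriv (besselKernel lam)) ζ := by
    rw [hK']; exact (hcSer_hasDerivAt (hcBd_shift (hcCoef_bd lam)) ζ).differentiableAt
  have h3 := (hasDerivAt_id ζ).mul hd.hasDerivAt
  have h4 := h2.unique h3
  have h5 : hcSer (fun n => (n + 1) * (((n + 1 : ℕ) : ℂ) * hcCoef lam (n + 1))) ζ
      = (-(lam : ℂ) ^ 2 / 4) * besselKernel lam ζ := by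
    rw [hc_bessel_eq]
    simp only [hcSer]
    rw [← tsum_mul_left]
    congr 1; ext n
    unfold hcCoef
    rw [Nat.factorial_succ]
    push_cast
    have h6 : (n.factorial : ℂ) ≠ 0 := by exact_mod_cast Nat.factorial_ne_zero n
    have h7 : (n : ℂ) + 1 ≠ 0 := by exact_mod_cast Nat.succ_ne_zero n
    field_simp
    ring
  rw [h5] at h4
  simp at h4
  linear_combination -h4

end Bessel

section Param
open Filter Topology MeasureTheory Set
open scoped ContDiff

lemma hc_par_bound {F : Type*} [NormedAddCommGroup F]
    {g : ℂ × ℝ → F} {O : Set (ℂ × ℝ)} {U : Set ℂ} (hU : IsOpen U)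
    (hUO : ∀ z ∈ U, ∀ t ∈ Icc (0:ℝ) 1, (z, t) ∈ O) (hg : ContinuousOn g O) {z : ℂ} (hz : z ∈ U) :
    ∃ r > 0, ∃ C : ℝ, Metric.ball z r ⊆ U ∧
      ∀ w ∈ Metric.ball z r, ∀ t ∈ Icc (0:ℝ) 1, ‖g (w, t)‖ ≤ C := by
  obtain ⟨r, hr, hrU⟩ := Metric.isOpen_iff.1 hU z hz
  have hsub : Metric.closedBall z (r/2) ⊆ U :=
    (Metric.closedBall_subset_ball (by linarith)).trans hrU
  have hc : IsCompact (Metric.closedBall z (r/2) ×ˢ Icc (0:ℝ) 1) :=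
    (isCompact_closedBall z (r/2)).prod isCompact_Icc
  obtain ⟨C, hC⟩ := hc.exists_bound_of_continuousOn (f := g)
    (hg.mono (fun p hp => hUO p.1 (hsub hp.1) p.2 hp.2))
  exact ⟨r/2, by linarith, C, Metric.ball_subset_closedBall.trans hsub,
    fun w hw t ht => hC (w, t) ⟨Metric.ball_subset_closedBall hw, ht⟩⟩

lemma hc_par_slice {F : Type*} [NormedAddCommGroup F]
    {g : ℂ × ℝ → F} {O : Set (ℂ × ℝ)} {U : Set ℂ}
    (hUO : ∀ z ∈ U, ∀ t ∈ Icc (0:ℝ) 1, (z, t) ∈ O) (hg : ContinuousOn g O) {z : ℂ} (hz : z ∈ U) :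
    ContinuousOn (fun t => g (z, t)) (Icc (0:ℝ) 1) :=
  hg.comp (by fun_prop) (fun t ht => hUO z hz t ht)

lemma hc_par_ii {F : Type*} [NormedAddCommGroup F]
    {g : ℂ × ℝ → F} {O : Set (ℂ × ℝ)} {U : Set ℂ}
    (hUO : ∀ z ∈ U, ∀ t ∈ Icc (0:ℝ) 1, (z, t) ∈ O) (hg : ContinuousOn g O) {z : ℂ} (hz : z ∈ U) :
    IntervalIntegrable (fun t => g (z, t)) volume 0 1 := by
  apply ContinuousOn.intervalIntegrable
  rw [uIcc_of_le zero_le_one]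
  exact hc_par_slice hUO hg hz

lemma hc_par_meas {F : Type*} [NormedAddCommGroup F]
    {g : ℂ × ℝ → F} {O : Set (ℂ × ℝ)} {U : Set ℂ}
    (hUO : ∀ z ∈ U, ∀ t ∈ Icc (0:ℝ) 1, (z, t) ∈ O) (hg : ContinuousOn g O) {z : ℂ} (hz : z ∈ U) :
    AEStronglyMeasurable (fun t => g (z, t)) (volume.restrict (Set.uIoc (0:ℝ) 1)) := by
  have := (hc_par_ii hUO hg hz).aestronglyMeasurable
  rwa [uIoc_of_le zero_le_one]

lemma hc_par_cont {F : Type*} [NormedAddCommGroup F] [NormedSpace ℝ F]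
    {g : ℂ × ℝ → F} {O : Set (ℂ × ℝ)} (hO : IsOpen O) {U : Set ℂ} (hU : IsOpen U)
    (hUO : ∀ z ∈ U, ∀ t ∈ Icc (0:ℝ) 1, (z, t) ∈ O) (hg : ContinuousOn g O) :
    ContinuousOn (fun z => ∫ t in (0:ℝ)..1, g (z, t)) U := by
  intro z hz
  apply ContinuousAt.continuousWithinAt
  obtain ⟨r, hr, C, hrU, hC⟩ := hc_par_bound hU hUO hg hz
  refine intervalIntegral.continuousAt_of_dominated_interval (bound := fun _ => C) ?_ ?_ (by simp) ?_
  · filter_upwards [hU.mem_nhds hz] with w hw using hc_par_meas hUO hg hw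
  · filter_upwards [Metric.ball_mem_nhds z hr] with w hw
    refine ae_of_all _ fun t ht => hC w hw t ?_
    rw [uIoc_of_le zero_le_one] at ht
    exact Ioc_subset_Icc_self ht
  · refine ae_of_all _ fun t ht => ?_
    rw [uIoc_of_le zero_le_one] at ht
    have h1 : ContinuousAt g (z, t) :=
      hg.continuousAt (hO.mem_nhds (hUO z hz t (Ioc_subset_Icc_self ht)))
    exact ContinuousAt.comp (f := fun x : ℂ => (x, t)) h1 (by fun_prop)

lemma hc_par_fderiv {F : Type*} [NormedAddCommGroup F] [NormedSpace ℝ F]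
    {g : ℂ × ℝ → F} {O : Set (ℂ × ℝ)} (hO : IsOpen O) {U : Set ℂ} (hU : IsOpen U)
    (hUO : ∀ z ∈ U, ∀ t ∈ Icc (0:ℝ) 1, (z, t) ∈ O) (hg : ContDiffOn ℝ 1 g O) {z : ℂ} (hz : z ∈ U) :
    HasFDerivAt (fun z => ∫ t in (0:ℝ)..1, g (z, t))
      (∫ t in (0:ℝ)..1, (fderiv ℝ g (z, t)).comp (ContinuousLinearMap.inl ℝ ℂ ℝ)) z := by
  have hg' : ContinuousOn (fun p => (fderiv ℝ g p).comp (ContinuousLinearMap.inl ℝ ℂ ℝ)) O :=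
    (hg.continuousOn_fderiv_of_isOpen hO le_rfl).clm_comp continuousOn_const
  obtain ⟨r, hr, C, hrU, hC⟩ := hc_par_bound hU hUO hg' hz
  refine intervalIntegral.hasFDerivAt_integral_of_dominated_of_fderiv_le (bound := fun _ => C)
    (F := fun z t => g (z, t))
    (F' := fun z t => (fderiv ℝ g (z, t)).comp (ContinuousLinearMap.inl ℝ ℂ ℝ))
    (Metric.ball_mem_nhds z hr) ?_ (hc_par_ii hUO hg.continuousOn hz)
    (hc_par_meas hUO hg' hz) ?_ (by simp) ?_
  · filter_upwards [hU.mem_nhds hz] with w hw using hc_par_meas hUO hg.continuousOn hw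
  · refine ae_of_all _ fun t ht w hw => hC w hw t ?_
    rw [uIoc_of_le zero_le_one] at ht
    exact Ioc_subset_Icc_self ht
  · refine ae_of_all _ fun t ht w hw => ?_
    rw [uIoc_of_le zero_le_one] at ht
    have h1 : DifferentiableAt ℝ g (w, t) :=
      (hg.contDiffAt (hO.mem_nhds (hUO w (hrU hw) t (Ioc_subset_Icc_self ht)))).differentiableAt
        (by norm_num)
    exact h1.hasFDerivAt.comp w (hasFDerivAt_prodMk_left w t)

lemma hc_par_contDiff (n : ℕ) : ∀ {F : Type} [NormedAddCommGroup F] [NormedSpace ℝ F]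
    {g : ℂ × ℝ → F} {O : Set (ℂ × ℝ)} (_hO : IsOpen O) {U : Set ℂ} (_hU : IsOpen U)
    (_hUO : ∀ z ∈ U, ∀ t ∈ Icc (0:ℝ) 1, (z, t) ∈ O) (_hg : ContDiffOn ℝ n g O),
    ContDiffOn ℝ n (fun z => ∫ t in (0:ℝ)..1, g (z, t)) U := by
  induction n with
  | zero =>
    intro F _ _ g O hO U hU hUO hg
    simp only [Nat.cast_zero] at hg ⊢
    exact contDiffOn_zero.2 (hc_par_cont hO hU hUO hg.continuousOn)
  | succ n ih =>
    intro F _ _ g O hO U hU hUO hg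
    push_cast at hg ⊢
    have hg1 : ContDiffOn ℝ 1 g O := hg.of_le (by exact_mod_cast le_add_left le_rfl)
    rw [contDiffOn_succ_iff_fderiv_of_isOpen hU]
    refine ⟨fun z hz => (hc_par_fderiv hO hU hUO hg1 hz).differentiableAt.differentiableWithinAt,
      by simp, ?_⟩
    have h2 := ih hO hU hUO (g := fun p => (fderiv ℝ g p).comp (ContinuousLinearMap.inl ℝ ℂ ℝ))
      ((((contDiffOn_succ_iff_fderiv_of_isOpen hO).1 hg).2.2).clm_comp contDiffOn_const)
    exact h2.congr fun z hz => (hc_par_fderiv hO hU hUO hg1 hz).fderiv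

/-- directional derivative in the parameter -/
noncomputable def hcD (v : ℂ) (g : ℂ × ℝ → ℂ) (p : ℂ × ℝ) : ℂ := fderiv ℝ g p (v, 0)

lemma hcD_contDiff {g : ℂ × ℝ → ℂ} {O : Set (ℂ × ℝ)} (hO : IsOpen O)
    (hg : ContDiffOn ℝ ∞ g O) (v : ℂ) : ContDiffOn ℝ ∞ (hcD v g) O :=
  (hg.fderiv_of_isOpen hO (by simp)).clm_apply contDiffOn_const

lemma hcD_int {g : ℂ × ℝ → ℂ} {O : Set (ℂ × ℝ)} (hO : IsOpen O) {U : Set ℂ} (hU : IsOpen U)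
    (hUO : ∀ z ∈ U, ∀ t ∈ Icc (0:ℝ) 1, (z, t) ∈ O) (hg : ContDiffOn ℝ ∞ g O) {z : ℂ} (hz : z ∈ U)
    (v : ℂ) : fderiv ℝ (fun z => ∫ t in (0:ℝ)..1, g (z, t)) z v
      = ∫ t in (0:ℝ)..1, hcD v g (z, t) := by
  have hg1 : ContDiffOn ℝ 1 g O := hg.of_le (by exact_mod_cast le_top)
  rw [(hc_par_fderiv hO hU hUO hg1 hz).fderiv]
  have hg' : ContinuousOn (fun p => (fderiv ℝ g p).comp (ContinuousLinearMap.inl ℝ ℂ ℝ)) O :=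
    (hg1.continuousOn_fderiv_of_isOpen hO le_rfl).clm_comp continuousOn_const
  rw [ContinuousLinearMap.intervalIntegral_apply (hc_par_ii hUO hg' hz)]
  rfl

lemma hcD_int2 {g : ℂ × ℝ → ℂ} {O : Set (ℂ × ℝ)} (hO : IsOpen O) {U : Set ℂ} (hU : IsOpen U)
    (hUO : ∀ z ∈ U, ∀ t ∈ Icc (0:ℝ) 1, (z, t) ∈ O) (hg : ContDiffOn ℝ ∞ g O) {z : ℂ} (hz : z ∈ U)
    (v w : ℂ) : fderiv ℝ (fun z => fderiv ℝ (fun z => ∫ t in (0:ℝ)..1, g (z, t)) z v) z w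
      = ∫ t in (0:ℝ)..1, hcD w (hcD v g) (z, t) := by
  rw [← hcD_int hO hU hUO (hcD_contDiff hO hg v) hz w]
  congr 1
  apply Filter.EventuallyEq.fderiv_eq
  filter_upwards [hU.mem_nhds hz] with y hy using hcD_int hO hU hUO hg hy v

/-- compute `hcD` along lines -/
lemma hcD_eq {g : ℂ × ℝ → ℂ} {O : Set (ℂ × ℝ)} (hO : IsOpen O)
    (hg : ContDiffOn ℝ ∞ g O) {z : ℂ} {t : ℝ} (hp : (z, t) ∈ O) (v : ℂ) {d : ℂ}
    (hd : HasDerivAt (fun s : ℝ => g (z + s * v, t)) d 0) : hcD v g (z, t) = d := by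
  have h1 : HasFDerivAt g (fderiv ℝ g (z, t)) (z, t) :=
    ((hg.contDiffAt (hO.mem_nhds hp)).differentiableAt (by simp)).hasFDerivAt
  have h2 : HasDerivAt (fun s : ℝ => (z + s * v, t)) (v, (0:ℝ)) 0 := by
    apply HasDerivAt.prodMk
    · simpa using ((hasDerivAt_id (0:ℝ)).ofReal_comp.mul_const v).const_add z
    · exact hasDerivAt_const _ _
  have h3 : HasFDerivAt g (fderiv ℝ g (z, t)) ((fun s : ℝ => (z + s * v, t)) 0) := by simpa using h1
  exact (h3.comp_hasDerivAt (0:ℝ) h2).unique hd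

end Param

section Exist
open Filter Topology MeasureTheory Set
open scoped ContDiff

lemma hcD_congr {g h : ℂ × ℝ → ℂ} {O : Set (ℂ × ℝ)} (hO : IsOpen O) (heq : EqOn g h O)
    {p : ℂ × ℝ} (hp : p ∈ O) (v : ℂ) : hcD v g p = hcD v h p := by
  unfold hcD
  rw [(heq.eventuallyEq_of_mem (hO.mem_nhds hp)).fderiv_eq]

/-- a function of three complex variables read on the real points -/
def hcLift (H : ℂ → ℂ → ℂ → ℂ) (p : ℂ × ℝ) : ℂ := H p.1.re p.1.im p.2

lemma hcLift_one {H : ℂ → ℂ → ℂ → ℂ} {O : Set (ℂ × ℝ)} (hO : IsOpen O)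
    (hg : ContDiffOn ℝ ∞ (hcLift H) O) {z : ℂ} {t : ℝ} (hp : (z, t) ∈ O) {d : ℂ}
    (hd : HasDerivAt (fun x : ℂ => H x z.im t) d z.re) : hcD 1 (hcLift H) (z, t) = d := by
  apply hcD_eq hO hg hp
  have h1 : HasDerivAt (fun s : ℝ => (z.re : ℂ) + s) 1 0 :=
    (hasDerivAt_id (0:ℝ)).ofReal_comp.const_add _
  have h2 : HasDerivAt (fun x : ℂ => H x z.im t) d ((fun s : ℝ => (z.re : ℂ) + s) 0) := by
    simpa using hd
  have := h2.comp (0:ℝ) h1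
  simpa [hcLift, Function.comp_def] using this

lemma hcLift_I {H : ℂ → ℂ → ℂ → ℂ} {O : Set (ℂ × ℝ)} (hO : IsOpen O)
    (hg : ContDiffOn ℝ ∞ (hcLift H) O) {z : ℂ} {t : ℝ} (hp : (z, t) ∈ O) {d : ℂ}
    (hd : HasDerivAt (fun y : ℂ => H z.re y t) d z.im) : hcD I (hcLift H) (z, t) = d := by
  apply hcD_eq hO hg hp
  have h1 : HasDerivAt (fun s : ℝ => (z.im : ℂ) + s) 1 0 :=
    (hasDerivAt_id (0:ℝ)).ofReal_comp.const_add _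
  have h2 : HasDerivAt (fun x : ℂ => H z.re x t) d ((fun s : ℝ => (z.im : ℂ) + s) 0) := by
    simpa using hd
  have := h2.comp (0:ℝ) h1
  simpa [hcLift, Function.comp_def] using this

/-- the argument of the Bessel kernel -/
def hcZ (y t : ℂ) : ℂ := 4 * y ^ 2 * (t * (1 - t))
/-- the point on the vertical segment -/
def hcPt (x y t : ℂ) : ℂ := x + I * y * (2 * t - 1)

lemma hcZ_y (k k' : ℂ → ℂ) (hk : ∀ z, HasDerivAt k (k' z) z) (y t : ℂ) :
    HasDerivAt (fun y => k (hcZ y t)) (k' (hcZ y t) * (8 * y * (t * (1 - t)))) y := by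
  have h : HasDerivAt (fun y => hcZ y t) (8 * y * (t * (1 - t))) y := by
    unfold hcZ
    have := (((hasDerivAt_id y).pow 2).const_mul 4).mul_const (t * (1 - t))
    refine (this.congr_deriv ?_)
    simp only [id, Nat.cast_ofNat]; ring
  exact (hk _).comp y h

lemma hcZ_t (k k' : ℂ → ℂ) (hk : ∀ z, HasDerivAt k (k' z) z) (y t : ℂ) :
    HasDerivAt (fun t => k (hcZ y t)) (k' (hcZ y t) * (4 * y ^ 2 * (1 - 2 * t))) t := by
  have h : HasDerivAt (fun t => hcZ y t) (4 * y ^ 2 * (1 - 2 * t)) t := by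
    unfold hcZ
    have := ((hasDerivAt_id t).mul ((hasDerivAt_id t).const_sub 1)).const_mul (4 * y ^ 2)
    refine (this.congr_deriv ?_)
    simp only [id, Nat.cast_ofNat]; ring
  exact (hk _).comp t h

lemma hcPt_x {f : ℂ → ℂ} {f' : ℂ} {x y t : ℂ} (hf : HasDerivAt f f' (hcPt x y t)) :
    HasDerivAt (fun x => f (hcPt x y t)) f' x := by
  have h : HasDerivAt (fun x => hcPt x y t) 1 x := (hasDerivAt_id x).add_const _
  exact (hf.comp x h).congr_deriv (mul_one _)

lemma hcPt_y {f : ℂ → ℂ} {f' : ℂ} {x y t : ℂ} (hf : HasDerivAt f f' (hcPt x y t)) :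
    HasDerivAt (fun y => f (hcPt x y t)) (f' * (I * (2 * t - 1))) y := by
  have h : HasDerivAt (fun y => hcPt x y t) (I * (2 * t - 1)) y := by
    have := (((hasDerivAt_id y).const_mul I).mul_const (2 * t - 1)).const_add x
    exact this.congr_deriv (by ring)
  exact hf.comp y h

lemma hcPt_t {f : ℂ → ℂ} {f' : ℂ} {x y t : ℂ} (hf : HasDerivAt f f' (hcPt x y t)) :
    HasDerivAt (fun t => f (hcPt x y t)) (f' * (2 * I * y)) t := by
  have h : HasDerivAt (fun t => hcPt x y t) (2 * I * y) t := by
    have := ((((hasDerivAt_id t).const_mul 2).sub_const 1).const_mul (I * y)).const_add x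
    refine this.congr_deriv (by ring)
  exact hf.comp t h

noncomputable def hcG (lam : ℝ) (f : ℂ → ℂ) (x y t : ℂ) : ℂ :=
  y * besselKernel lam (hcZ y t) * f (hcPt x y t)

/-- closed form of the first derivative in the vertical direction -/
noncomputable def hcGy (lam : ℝ) (f : ℂ → ℂ) (x y t : ℂ) : ℂ :=
  (besselKernel lam (hcZ y t) + y * (deriv (besselKernel lam) (hcZ y t) * (8 * y * (t * (1 - t)))))
    * f (hcPt x y t)
  + y * besselKernel lam (hcZ y t) * (deriv f (hcPt x y t) * (I * (2 * t - 1)))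

lemma hc_K1 (lam : ℝ) (z : ℂ) : HasDerivAt (besselKernel lam) (deriv (besselKernel lam) z) z :=
  (hc_bessel_diff lam z).hasDerivAt

lemma hc_K2 (lam : ℝ) (z : ℂ) :
    HasDerivAt (deriv (besselKernel lam)) (deriv (deriv (besselKernel lam)) z) z :=
  ((hc_bessel_diff lam).deriv z).hasDerivAt

def hcO (Ω : Set ℂ) : Set (ℂ × ℝ) := {p | hcPt p.1.re p.1.im p.2 ∈ Ω}

lemma hcPt_smooth : ContDiff ℝ ∞ (fun p : ℂ × ℝ => hcPt p.1.re p.1.im p.2) := by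
  unfold hcPt
  have h1 : ContDiff ℝ ∞ (fun p : ℂ × ℝ => (p.1.re : ℂ)) :=
    (ofRealCLM.comp (reCLM.comp (ContinuousLinearMap.fst ℝ ℂ ℝ))).contDiff
  have h2 : ContDiff ℝ ∞ (fun p : ℂ × ℝ => (p.1.im : ℂ)) :=
    (ofRealCLM.comp (imCLM.comp (ContinuousLinearMap.fst ℝ ℂ ℝ))).contDiff
  have h3 : ContDiff ℝ ∞ (fun p : ℂ × ℝ => (p.2 : ℂ)) :=
    (ofRealCLM.comp ((ContinuousLinearMap.snd ℝ ℂ ℝ))).contDiff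
  fun_prop

lemma hcZ_smooth : ContDiff ℝ ∞ (fun p : ℂ × ℝ => hcZ p.1.im p.2) := by
  unfold hcZ
  have h2 : ContDiff ℝ ∞ (fun p : ℂ × ℝ => (p.1.im : ℂ)) :=
    (ofRealCLM.comp (imCLM.comp (ContinuousLinearMap.fst ℝ ℂ ℝ))).contDiff
  have h3 : ContDiff ℝ ∞ (fun p : ℂ × ℝ => (p.2 : ℂ)) :=
    (ofRealCLM.comp ((ContinuousLinearMap.snd ℝ ℂ ℝ))).contDiff
  fun_prop

lemma hcO_open {Ω : Set ℂ} (hΩ : IsOpen Ω) : IsOpen (hcO Ω) :=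
  hΩ.preimage hcPt_smooth.continuous

lemma hcG_smooth (lam : ℝ) {f : ℂ → ℂ} {Ω : Set ℂ} (hΩ : IsOpen Ω) (hf : DifferentiableOn ℂ f Ω) :
    ContDiffOn ℝ ∞ (hcLift (hcG lam f)) (hcO Ω) := by
  have h1 : ContDiffOn ℝ ∞ f Ω := (hf.contDiffOn (n := ∞) hΩ).restrict_scalars ℝ
  have h2 : ContDiff ℝ ∞ (besselKernel lam) :=
    ((hc_bessel_diff lam).contDiff (n := ∞)).restrict_scalars ℝ
  have h3 : ContDiff ℝ ∞ (fun p : ℂ × ℝ => (p.1.im : ℂ)) :=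
    (ofRealCLM.comp (imCLM.comp (ContinuousLinearMap.fst ℝ ℂ ℝ))).contDiff
  exact (h3.mul (h2.comp hcZ_smooth)).contDiffOn.mul
    (h1.comp hcPt_smooth.contDiffOn (fun p hp => hp))

section
variable {lam : ℝ} {f : ℂ → ℂ} {Ω : Set ℂ}

lemma hcf1 (hΩ : IsOpen Ω) (hf : DifferentiableOn ℂ f Ω) {z : ℂ} (hz : z ∈ Ω) :
    HasDerivAt f (deriv f z) z := (hf.differentiableAt (hΩ.mem_nhds hz)).hasDerivAt

lemma hcG_D1 (hΩ : IsOpen Ω) (hf : DifferentiableOn ℂ f Ω) {p : ℂ × ℝ} (hp : p ∈ hcO Ω) :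
    hcD 1 (hcLift (hcG lam f)) p = hcLift (hcG lam (deriv f)) p := by
  obtain ⟨z, t⟩ := p
  exact hcLift_one (hcO_open hΩ) (hcG_smooth lam hΩ hf) hp
    ((hcPt_x (hcf1 hΩ hf hp)).const_mul _)

lemma hcG_D11 (hΩ : IsOpen Ω) (hf : DifferentiableOn ℂ f Ω) {p : ℂ × ℝ} (hp : p ∈ hcO Ω) :
    hcD 1 (hcD 1 (hcLift (hcG lam f))) p = hcLift (hcG lam (deriv (deriv f))) p := by
  rw [hcD_congr (hcO_open hΩ) (fun q hq => hcG_D1 hΩ hf hq) hp]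
  exact hcG_D1 hΩ (hf.deriv hΩ) hp

lemma hcG_DI (hΩ : IsOpen Ω) (hf : DifferentiableOn ℂ f Ω) {p : ℂ × ℝ} (hp : p ∈ hcO Ω) :
    hcD I (hcLift (hcG lam f)) p = hcLift (hcGy lam f) p := by
  obtain ⟨z, t⟩ := p
  refine hcLift_I (hcO_open hΩ) (hcG_smooth lam hΩ hf) hp ?_
  have := ((hasDerivAt_id (z.im : ℂ)).mul (hcZ_y _ _ (hc_K1 lam) z.im t)).mul
    (hcPt_y (hcf1 hΩ hf hp))
  refine this.congr_deriv ?_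
  simp [hcGy, hcLift]

/-- second vertical derivative -/
noncomputable def hcGyy (lam : ℝ) (f : ℂ → ℂ) (x y t : ℂ) : ℂ :=
  let k0 := besselKernel lam (hcZ y t)
  let k1 := deriv (besselKernel lam) (hcZ y t)
  let k2 := deriv (deriv (besselKernel lam)) (hcZ y t)
  let f0 := f (hcPt x y t)
  let f1 := deriv f (hcPt x y t)
  let f2 := deriv (deriv f) (hcPt x y t)
  let e := 8 * y * (t * (1 - t))
  let i := I * (2 * t - 1)
  k1 * e * f0 + k0 * f1 * i + (16 * y * (t * (1 - t)) * k1 * f0 + y * e * k2 * e * f0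
    + y * e * k1 * f1 * i) + (k0 * f1 * i + y * k1 * e * f1 * i + y * k0 * f2 * i * i)

lemma hcG_DII (hΩ : IsOpen Ω) (hf : DifferentiableOn ℂ f Ω) {p : ℂ × ℝ} (hp : p ∈ hcO Ω) :
    hcD I (hcD I (hcLift (hcG lam f))) p = hcLift (hcGyy lam f) p := by
  rw [hcD_congr (hcO_open hΩ) (fun q hq => hcG_DI hΩ hf hq) hp]
  have hs : ContDiffOn ℝ ∞ (hcLift (hcGy lam f)) (hcO Ω) :=
    (hcD_contDiff (hcO_open hΩ) (hcG_smooth lam hΩ hf) I).congr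
      (fun q hq => (hcG_DI hΩ hf hq).symm)
  obtain ⟨z, t⟩ := p
  refine hcLift_I (hcO_open hΩ) hs hp ?_
  have hid := hasDerivAt_id (z.im : ℂ)
  have h0 := hcZ_y _ _ (hc_K1 lam) z.im t
  have h1 := hcZ_y _ _ (hc_K2 lam) z.im t
  have g0 := hcPt_y (hcf1 hΩ hf hp)
  have g1 := hcPt_y (hcf1 hΩ (hf.deriv hΩ) hp)
  have := ((h0.add (hid.mul (h1.mul ((hid.const_mul 8).mul_const ((t:ℂ) * (1 - t)))))).mul g0).add
    ((hid.mul h0).mul (g1.mul_const (I * (2 * (t:ℂ) - 1))))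
  refine this.congr_deriv ?_
  simp [hcGyy, hcLift]
  ring

/-- the primitive -/
noncomputable def hcM (lam : ℝ) (f : ℂ → ℂ) (x y t : ℂ) : ℂ :=
  (4 * t * (1 - t)) * (- I * (besselKernel lam (hcZ y t) * deriv f (hcPt x y t))
    + 2 * y * (2 * t - 1) * (deriv (besselKernel lam) (hcZ y t) * f (hcPt x y t)))

lemma hcM_deriv (hΩ : IsOpen Ω) (hf : DifferentiableOn ℂ f Ω) {z : ℂ} {t : ℝ}
    (hp : (z, t) ∈ hcO Ω) : HasDerivAt (fun t : ℝ => hcM lam f z.re z.im t)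
      (2 * (hcLift (hcG lam (deriv (deriv f))) (z, t) + hcLift (hcGyy lam f) (z, t)
        + lam ^ 2 * hcLift (hcG lam f) (z, t))) t := by
  have hid := hasDerivAt_id (t : ℂ)
  have h0 := hcZ_t _ _ (hc_K1 lam) z.im t
  have h1 := hcZ_t _ _ (hc_K2 lam) z.im t
  have g0 := hcPt_t (hcf1 hΩ hf hp)
  have g1 := hcPt_t (hcf1 hΩ (hf.deriv hΩ) hp)
  have := ((hid.const_mul 4).mul (hid.const_sub 1)).mul (((h0.mul g1).const_mul (-I)).add
    ((((hid.const_mul 2).sub_const 1).const_mul (2 * (z.im:ℂ))).mul (h1.mul g0)))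
  refine (this.congr_deriv ?_).comp_ofReal
  have ode := hc_bessel_ode lam (hcZ z.im t)
  simp only [hcLift, hcG, hcGyy, id, Pi.mul_apply, Pi.add_apply]
  generalize besselKernel lam (hcZ z.im t) = k0 at *
  generalize deriv (besselKernel lam) (hcZ z.im t) = k1 at *
  generalize deriv (deriv (besselKernel lam)) (hcZ z.im t) = k2 at *
  generalize f (hcPt z.re z.im t) = f0 at *
  generalize deriv f (hcPt z.re z.im t) = f1 at *
  generalize deriv (deriv f) (hcPt z.re z.im t) = f2 at *
  simp only [hcZ] at ode
  linear_combination (-8 * z.im * f0) * ode + (-2 * z.im * k0 * f2) * I_sq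

end
end Exist

section Exist2
open Filter Topology MeasureTheory Set
open scoped ContDiff

noncomputable def hcP (lam : ℝ) (f : ℂ → ℂ) (z : ℂ) : ℂ :=
  ∫ t in (0:ℝ)..1, hcLift (hcG lam f) (z, t)

variable {lam : ℝ} {f : ℂ → ℂ} {Ω U : Set ℂ}

lemma hcP_contDiff (hΩ : IsOpen Ω) (hf : DifferentiableOn ℂ f Ω) (hU : IsOpen U)
    (hUO : ∀ z ∈ U, ∀ t ∈ Icc (0:ℝ) 1, (z, t) ∈ hcO Ω) (n : ℕ) :
    ContDiffOn ℝ n (hcP lam f) U :=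
  hc_par_contDiff n (hcO_open hΩ) hU hUO ((hcG_smooth lam hΩ hf).of_le (by exact_mod_cast le_top))

lemma hcP_helm (hΩ : IsOpen Ω) (hf : DifferentiableOn ℂ f Ω) (hU : IsOpen U)
    (hUO : ∀ z ∈ U, ∀ t ∈ Icc (0:ℝ) 1, (z, t) ∈ hcO Ω) {z : ℂ} (hz : z ∈ U) :
    hcLap (hcP lam f) z + (lam:ℂ) ^ 2 * hcP lam f z = 0 := by
  have hO := hcO_open hΩ
  have hg := hcG_smooth lam hΩ hf
  have e1 := hcD_int2 hO hU hUO hg hz 1 1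
  have e2 := hcD_int2 hO hU hUO hg hz I I
  have c1 := hc_par_ii hUO (hcD_contDiff hO (hcD_contDiff hO hg 1) 1).continuousOn hz
  have c2 := hc_par_ii hUO (hcD_contDiff hO (hcD_contDiff hO hg I) I).continuousOn hz
  have c0 := hc_par_ii hUO hg.continuousOn hz
  have key := intervalIntegral.integral_eq_sub_of_hasDerivAt (a := 0) (b := 1)
    (f := fun t : ℝ => hcM lam f z.re z.im t)
    (f' := fun t : ℝ => 2 * (hcD 1 (hcD 1 (hcLift (hcG lam f))) (z, t)
      + hcD I (hcD I (hcLift (hcG lam f))) (z, t)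
        + lam ^ 2 * hcLift (hcG lam f) (z, t))) ?_ (((c1.add c2).add (c0.const_mul _)).const_mul _)
  · rw [intervalIntegral.integral_const_mul, intervalIntegral.integral_add (c1.add c2)
      (c0.const_mul _), intervalIntegral.integral_add c1 c2,
      intervalIntegral.integral_const_mul] at key
    simp only [hcM] at key
    norm_num at key
    unfold hcLap
    change fderiv ℝ (fun z => fderiv ℝ (fun z => ∫ t in (0:ℝ)..1, hcLift (hcG lam f) (z, t)) z 1) z 1
      + fderiv ℝ (fun z => fderiv ℝ (fun z => ∫ t in (0:ℝ)..1, hcLift (hcG lam f) (z, t)) z I) z I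
      + (lam:ℂ) ^ 2 * ∫ t in (0:ℝ)..1, hcLift (hcG lam f) (z, t) = 0
    rw [e1, e2]
    exact key
  · intro t ht
    rw [uIcc_of_le zero_le_one] at ht
    have hp := hUO z hz t ht
    rw [hcG_D11 hΩ hf hp, hcG_DII hΩ hf hp]
    exact hcM_deriv hΩ hf hp

lemma hcP_DI (hΩ : IsOpen Ω) (hf : DifferentiableOn ℂ f Ω) (hU : IsOpen U)
    (hUO : ∀ z ∈ U, ∀ t ∈ Icc (0:ℝ) 1, (z, t) ∈ hcO Ω) {z : ℂ} (hz : z ∈ U) :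
    fderiv ℝ (hcP lam f) z I = (f (z.re + I * z.im) + f (z.re - I * z.im)) / 2
      + 2 * z.im ^ 2 * ∫ t in (0:ℝ)..1,
        deriv (besselKernel lam) (hcZ z.im t) * f (hcPt z.re z.im t) := by
  have hO := hcO_open hΩ
  have hg := hcG_smooth lam hΩ hf
  have e2 := hcD_int hO hU hUO hg hz I
  have c2 := hc_par_ii hUO (hcD_contDiff hO hg I).continuousOn hz
  have hfc : ContinuousOn (fun p : ℂ × ℝ => f (hcPt p.1.re p.1.im p.2)) (hcO Ω) :=
    hf.continuousOn.comp hcPt_smooth.continuous.continuousOn (fun p hp => hp)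
  have hK : Continuous (deriv (besselKernel lam)) := (hc_bessel_diff lam).deriv.continuous
  have c3 := hc_par_ii hUO ((hK.comp hcZ_smooth.continuous).continuousOn.mul hfc) hz
  simp only [Function.comp_def, Pi.mul_apply] at c3
  have key := intervalIntegral.integral_eq_sub_of_hasDerivAt (a := 0) (b := 1)
    (f := fun t : ℝ => (2 * (t:ℂ) - 1) * besselKernel lam (hcZ z.im t) * f (hcPt z.re z.im t))
    (f' := fun t : ℝ => 2 * (hcD I (hcLift (hcG lam f)) (z, t)
        - 2 * z.im ^ 2 * (deriv (besselKernel lam) (hcZ z.im t) * f (hcPt z.re z.im t))))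
        ?_ ((c2.sub (c3.const_mul _)).const_mul _)
  · rw [intervalIntegral.integral_const_mul, intervalIntegral.integral_sub c2
      (c3.const_mul _), intervalIntegral.integral_const_mul, ← e2] at key
    simp only [hcZ, hcPt] at key ⊢
    norm_num [hc_bessel_zero] at key
    change fderiv ℝ (fun z => ∫ t in (0:ℝ)..1, hcLift (hcG lam f) (z, t)) z I = _
    rw [sub_eq_add_neg (z.re : ℂ)]
    linear_combination key / 2
  · intro t ht
    rw [uIcc_of_le zero_le_one] at ht
    have hp := hUO z hz t ht
    rw [hcG_DI hΩ hf hp]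
    have hid := hasDerivAt_id (t : ℂ)
    have := ((((hid.const_mul 2).sub_const 1)).mul (hcZ_t _ _ (hc_K1 lam) z.im t)).mul
      (hcPt_t (hcf1 hΩ hf hp))
    refine (this.congr_deriv ?_).comp_ofReal
    simp only [hcLift, hcGy, id, Pi.mul_apply, Pi.add_apply]
    ring

lemma hc_lap_DI {w : ℂ → ℂ} (hU : IsOpen U) (hw : ContDiffOn ℝ 3 w U)
    (heq : ∀ z ∈ U, hcLap w z + (lam:ℂ) ^ 2 * w z = 0) {z : ℂ} (hz : z ∈ U) :
    hcLap (fun z => fderiv ℝ w z I) z + (lam:ℂ) ^ 2 * fderiv ℝ w z I = 0 := by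
  have hA : ∀ v, ContDiffOn ℝ 2 (fun z => fderiv ℝ w z v) U := fun v =>
    (hw.fderiv_of_isOpen hU (by norm_num)).clm_apply contDiffOn_const
  have hB : ∀ v v', ContDiffOn ℝ 1 (fun z => fderiv ℝ (fun z => fderiv ℝ w z v) z v') U :=
    fun v v' => ((hA v).fderiv_of_isOpen hU (by norm_num)).clm_apply contDiffOn_const
  have hBd : ∀ v v', DifferentiableAt ℝ (fun z => fderiv ℝ (fun z => fderiv ℝ w z v) z v') z :=
    fun v v' => ((hB v v').contDiffAt (hU.mem_nhds hz)).differentiableAt (by norm_num)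
  have hwd : DifferentiableAt ℝ w z :=
    (hw.contDiffAt (hU.mem_nhds hz)).differentiableAt (by norm_num)
  have e1 : fderiv ℝ (fun z => fderiv ℝ (fun z => fderiv ℝ w z I) z 1) z 1
      = fderiv ℝ (fun z => fderiv ℝ (fun z => fderiv ℝ w z 1) z 1) z I := by
    rw [← hc_symm ((hA 1).contDiffAt (hU.mem_nhds hz)) I 1]
    congr 1
    apply Filter.EventuallyEq.fderiv_eq
    filter_upwards [hU.mem_nhds hz] with y hy
    exact hc_symm ((hw.contDiffAt (hU.mem_nhds hy)).of_le (by norm_num)) I 1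
  have e2 : fderiv ℝ (fun z => hcLap w z + (lam:ℂ) ^ 2 * w z) z = 0 := by
    have : (fun z => hcLap w z + (lam:ℂ) ^ 2 * w z) =ᶠ[𝓝 z] fun _ => 0 := by
      filter_upwards [hU.mem_nhds hz] with y hy using heq y hy
    rw [this.fderiv_eq]; simp
  have e3 := ((hBd 1 1).hasFDerivAt.add (hBd I I).hasFDerivAt).add
    (hwd.hasFDerivAt.const_mul ((lam:ℂ)^2))
  have e4 := e3.fderiv.symm.trans e2
  have e5 := congrArg (fun L : ℂ →L[ℝ] ℂ => L I) e4
  simp at e5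
  unfold hcLap
  rw [e1]
  exact e5

end Exist2

section Final
open Filter Topology MeasureTheory Set
open scoped ContDiff

lemma hc_line {E : Type*} [NormedAddCommGroup E] [NormedSpace ℝ E] {h : ℂ → E} {z v : ℂ} {t : ℝ}
    (hd : DifferentiableAt ℝ h (z + t * v)) :
    HasDerivAt (fun s : ℝ => h (z + s * v)) (fderiv ℝ h (z + t * v) v) t := by
  have h2 : HasDerivAt (fun s : ℝ => z + s * v) v t := by
    simpa using ((hasDerivAt_id t).ofReal_comp.mul_const v).const_add z
  exact hd.hasFDerivAt.comp_hasDerivAt t h2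

lemma hc_line2 {u : ℂ → ℝ} {Ω : Set ℂ} (hΩ : IsOpen Ω) (hu : ContDiffOn ℝ 2 u Ω) {z : ℂ}
    (hz : z ∈ Ω) (v : ℂ) :
    deriv (fun t : ℝ => deriv (fun s : ℝ => u (z + (s : ℂ) * v)) t) 0
      = fderiv ℝ (fun z => fderiv ℝ u z v) z v := by
  have hA : ContDiffOn ℝ 1 (fun z => fderiv ℝ u z v) Ω :=
    (hu.fderiv_of_isOpen hΩ (by norm_num)).clm_apply contDiffOn_const
  have h0 : ∀ᶠ t : ℝ in 𝓝 0, z + t * v ∈ Ω := by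
    have : ContinuousAt (fun t : ℝ => z + t * v) 0 := by fun_prop
    exact this (hΩ.mem_nhds (by simpa using hz))
  have h1 : (fun t : ℝ => deriv (fun s : ℝ => u (z + (s : ℂ) * v)) t)
      =ᶠ[𝓝 0] fun t : ℝ => fderiv ℝ u (z + t * v) v := by
    filter_upwards [h0] with t ht
    exact (hc_line ((hu.contDiffAt (hΩ.mem_nhds ht)).differentiableAt (by norm_num))).deriv
  rw [h1.deriv_eq]
  have h3 : DifferentiableAt ℝ (fun z => fderiv ℝ u z v) (z + (0:ℝ) * v) := by
    have := (hA.contDiffAt (hΩ.mem_nhds hz)).differentiableAt (by norm_num)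
    simpa using this
  simpa using (hc_line h3).deriv

lemma hc_ofReal_fderiv {u : ℂ → ℝ} {z : ℂ} (hu : DifferentiableAt ℝ u z) (v : ℂ) :
    fderiv ℝ (fun z => (u z : ℂ)) z v = (fderiv ℝ u z v : ℝ) := by
  have := (ofRealCLM.hasFDerivAt (x := u z)).comp z hu.hasFDerivAt
  have h2 : HasFDerivAt (fun z => (u z : ℂ)) (ofRealCLM.comp (fderiv ℝ u z)) z := this
  rw [h2.fderiv]; rfl

lemma hc_ofReal_fderiv2 {u : ℂ → ℝ} {Ω : Set ℂ} (hΩ : IsOpen Ω) (hu : ContDiffOn ℝ 2 u Ω) {z : ℂ}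
    (hz : z ∈ Ω) (v : ℂ) :
    fderiv ℝ (fun z => fderiv ℝ (fun z => (u z : ℂ)) z v) z v
      = (fderiv ℝ (fun z => fderiv ℝ u z v) z v : ℝ) := by
  have hA : ContDiffOn ℝ 1 (fun z => fderiv ℝ u z v) Ω :=
    (hu.fderiv_of_isOpen hΩ (by norm_num)).clm_apply contDiffOn_const
  rw [← hc_ofReal_fderiv ((hA.contDiffAt (hΩ.mem_nhds hz)).differentiableAt (by norm_num))]
  congr 1
  apply Filter.EventuallyEq.fderiv_eq
  filter_upwards [hΩ.mem_nhds hz] with y hy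
  exact hc_ofReal_fderiv ((hu.contDiffAt (hΩ.mem_nhds hy)).differentiableAt (by norm_num)) v

lemma hc_lap_sub_add {f g h : ℂ → ℂ} {U : Set ℂ} (hU : IsOpen U) (hf : ContDiffOn ℝ 2 f U)
    (hg : ContDiffOn ℝ 2 g U) (hh : ContDiffOn ℝ 2 h U) {z : ℂ} (hz : z ∈ U) :
    hcLap (fun z => f z - (g z + h z)) z = hcLap f z - (hcLap g z + hcLap h z) := by
  have hd : ∀ {k : ℂ → ℂ}, ContDiffOn ℝ 2 k U → ∀ y ∈ U, DifferentiableAt ℝ k y := fun hk y hy =>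
    (hk.contDiffAt (hU.mem_nhds hy)).differentiableAt (by norm_num)
  have hd1 : ∀ {k : ℂ → ℂ}, ContDiffOn ℝ 2 k U → ∀ v,
      DifferentiableAt ℝ (fun z => fderiv ℝ k z v) z := fun {k} hk v => by
    have hA : ContDiffOn ℝ 1 (fun z => fderiv ℝ k z v) U :=
      (hk.fderiv_of_isOpen hU (by norm_num)).clm_apply contDiffOn_const
    exact (hA.contDiffAt (hU.mem_nhds hz)).differentiableAt (by norm_num)
  have key : ∀ v, fderiv ℝ (fun z => fderiv ℝ (fun z => f z - (g z + h z)) z v) z v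
      = fderiv ℝ (fun z => fderiv ℝ f z v) z v - (fderiv ℝ (fun z => fderiv ℝ g z v) z v
        + fderiv ℝ (fun z => fderiv ℝ h z v) z v) := by
    intro v
    have e : (fun z => fderiv ℝ (fun z => f z - (g z + h z)) z v) =ᶠ[𝓝 z]
        fun z => fderiv ℝ f z v - (fderiv ℝ g z v + fderiv ℝ h z v) := by
      filter_upwards [hU.mem_nhds hz] with y hy
      have := (hd hf y hy).hasFDerivAt.sub ((hd hg y hy).hasFDerivAt.add (hd hh y hy).hasFDerivAt)
      exact congrArg (fun L : ℂ →L[ℝ] ℂ => L v) this.fderiv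
    rw [e.fderiv_eq]
    have := (hd1 hf v).hasFDerivAt.sub ((hd1 hg v).hasFDerivAt.add (hd1 hh v).hasFDerivAt)
    exact congrArg (fun L : ℂ →L[ℝ] ℂ => L v) this.fderiv
  unfold hcLap
  rw [key, key]
  ring

lemma hc_rect {Ω : Set ℂ} (hΩ : IsOpen Ω) {z₀ : ℂ}
    (hseg : segment ℝ ((starRingEnd ℂ) z₀) z₀ ⊆ Ω) :
    ∃ ε > 0, ∃ B : ℝ, |z₀.im| < B ∧ ∀ z : ℂ, |z.re - z₀.re| < ε → |z.im| < B → z ∈ Ω := by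
  have hc : IsCompact (segment ℝ ((starRingEnd ℂ) z₀) z₀) := by
    rw [segment_eq_image]
    exact isCompact_Icc.image (by fun_prop)
  obtain ⟨δ, hδ, hsub⟩ := hc.exists_thickening_subset_open hΩ hseg
  refine ⟨δ/2, by linarith, |z₀.im| + δ/2, by linarith, fun z h1 h2 => hsub ?_⟩
  set B := |z₀.im| + δ/2 with hB
  have hBpos : 0 < B := by positivity
  rw [Metric.mem_thickening_iff]
  have hy : |z.im / B| < 1 := by rw [abs_div, abs_of_pos hBpos, div_lt_one hBpos]; exact h2
  have hyl := abs_lt.1 hy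
  refine ⟨⟨z₀.re, z.im * |z₀.im| / B⟩, ?_, ?_⟩
  · have hs : ∀ s : ℝ, -1 ≤ s → s ≤ 1 →
        (⟨z₀.re, s * z₀.im⟩ : ℂ) ∈ segment ℝ ((starRingEnd ℂ) z₀) z₀ := by
      intro s h1 h2
      refine ⟨(1 - s)/2, (1 + s)/2, by linarith, by linarith, by ring, ?_⟩
      apply Complex.ext
      · simp; ring
      · simp; ring
    rcases abs_choice z₀.im with h | h
    · rw [h]
      have := hs (z.im / B) hyl.1.le hyl.2.le
      convert this using 2; ring
    · rw [h]
      have := hs (-(z.im / B)) (by linarith) (by linarith)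
      convert this using 2; ring
  · rw [Complex.dist_eq]
    refine (Complex.norm_le_abs_re_add_abs_im _).trans_lt ?_
    simp only [sub_re, sub_im]
    have : |z.im - z.im * |z₀.im| / B| < δ / 2 := by
      have e : z.im - z.im * |z₀.im| / B = (z.im / B) * (δ/2) := by
        field_simp; rw [hB]; ring
      rw [e, abs_mul, abs_of_pos (show 0 < δ/2 by linarith)]
      nlinarith
    linarith

end Final

/-- Representation of solutions of the Cauchy problem for the Helmholtz
equation `Δu + λ²u = 0` (formula (CRH)) specialized to the real axis:
`u(z₀) = ½(Φ(z₀)+Φ(w₀)) − ((z₀−w₀)/2)∫ Φ K' − (i/2)∫ K Ψ`, `w₀ = conj z₀`,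
with `Φ, Ψ` the holomorphic continuations of the Dirichlet and Neumann data. -/
theorem helmholtz_cauchy_representation_real_axis
    (lam : ℝ) (Ω : Set ℂ) (hΩ : IsOpen Ω) (hconn : IsConnected Ω)
    (hsym : ∀ z ∈ Ω, (starRingEnd ℂ) z ∈ Ω)
    (hreal : ∃ x : ℝ, (x : ℂ) ∈ Ω)
    (u : ℂ → ℝ) (hu : ContDiffOn ℝ 2 u Ω)
    (hhelm : ∀ z ∈ Ω,
      (deriv (fun t : ℝ => deriv (fun s : ℝ => u (z + (s : ℂ))) t) 0
        + deriv (fun t : ℝ => deriv (fun s : ℝ => u (z + (s : ℂ) * I)) t) 0)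
        + lam ^ 2 * u z = 0)
    (Φ Ψ : ℂ → ℂ)
    (hΦ : DifferentiableOn ℂ Φ Ω) (hΨ : DifferentiableOn ℂ Ψ Ω)
    (hbdD : ∀ x : ℝ, (x : ℂ) ∈ Ω → Φ (x : ℂ) = (u (x : ℂ) : ℂ))
    (hbdN : ∀ x : ℝ, (x : ℂ) ∈ Ω →
      Ψ (x : ℂ) = ((deriv (fun t : ℝ => u ((x : ℂ) + (t : ℂ) * I)) 0 : ℝ) : ℂ)) :
    ∀ z₀ ∈ Ω, segment ℝ ((starRingEnd ℂ) z₀) z₀ ⊆ Ω →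
      (u z₀ : ℂ) =
        (Φ z₀ + Φ ((starRingEnd ℂ) z₀)) / 2
          - ((z₀ - (starRingEnd ℂ) z₀) / 2) *
              segIntegral
                (fun z => Φ z *
                  deriv (besselKernel lam) ((z - z₀) * (z - (starRingEnd ℂ) z₀)))
                ((starRingEnd ℂ) z₀) z₀
          - (I / 2) *
              segIntegral
                (fun z => besselKernel lam ((z - z₀) * (z - (starRingEnd ℂ) z₀)) * Ψ z)
                ((starRingEnd ℂ) z₀) z₀ := by
  classical
  intro z₀ hz₀ hseg
  obtain ⟨ε, hε, B, hB, hR⟩ := hc_rect hΩ hseg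
  have hUo : IsOpen {z : ℂ | |z.re - z₀.re| < ε ∧ |z.im| < B} :=
    (isOpen_lt (continuous_re.sub continuous_const).abs continuous_const).inter
      (isOpen_lt continuous_im.abs continuous_const)
  have hUO : ∀ z ∈ {z : ℂ | |z.re - z₀.re| < ε ∧ |z.im| < B}, ∀ t ∈ Set.Icc (0:ℝ) 1,
      (z, t) ∈ hcO Ω := by
    rintro z ⟨h1, h2⟩ t ⟨ht0, ht1⟩
    refine hR _ ?_ ?_
    · simpa [hcPt] using h1
    · have e : (hcPt z.re z.im t).im = z.im * (2 * t - 1) := by simp [hcPt]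
      change |(hcPt z.re z.im t).im| < B
      rw [e, abs_mul]
      have : |2 * t - 1| ≤ 1 := abs_le.2 ⟨by linarith, by linarith⟩
      nlinarith [abs_nonneg z.im]
  have hUΩ : {z : ℂ | |z.re - z₀.re| < ε ∧ |z.im| < B} ⊆ Ω := fun z hz => hR z hz.1 hz.2
  have hB0 : 0 < B := (abs_nonneg _).trans_lt hB
  have haxis : ∀ x : ℝ, |x - z₀.re| < ε → (x:ℂ) ∈ {z : ℂ | |z.re - z₀.re| < ε ∧ |z.im| < B} :=
    fun x hx => ⟨by simpa using hx, by simpa using hB0⟩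
  generalize hUdef : {z : ℂ | |z.re - z₀.re| < ε ∧ |z.im| < B} = U at *
  have cu : ContDiffOn ℝ 2 (fun z => (u z : ℂ)) U :=
    ofRealCLM.contDiff.comp_contDiffOn (hu.mono hUΩ)
  have cΦ3 : ContDiffOn ℝ 3 (hcP lam Φ) U := hcP_contDiff hΩ hΦ hUo hUO 3
  have cΦ : ContDiffOn ℝ 2 (fun z => fderiv ℝ (hcP lam Φ) z I) U :=
    (cΦ3.fderiv_of_isOpen hUo (by norm_num)).clm_apply contDiffOn_const
  have cΨ : ContDiffOn ℝ 2 (hcP lam Ψ) U := hcP_contDiff hΩ hΨ hUo hUO 2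
  have lu : ∀ z ∈ U, hcLap (fun z => (u z : ℂ)) z + (lam:ℂ)^2 * u z = 0 := by
    intro z hz
    have h := hhelm z (hUΩ hz)
    have e1 := hc_line2 hΩ hu (hUΩ hz) 1
    simp only [mul_one] at e1
    rw [e1, hc_line2 hΩ hu (hUΩ hz) I] at h
    unfold hcLap
    rw [hc_ofReal_fderiv2 hΩ hu (hUΩ hz), hc_ofReal_fderiv2 hΩ hu (hUΩ hz)]
    exact_mod_cast h
  have lΦ0 : ∀ z ∈ U, hcLap (hcP lam Φ) z + (lam:ℂ)^2 * hcP lam Φ z = 0 :=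
    fun z hz => hcP_helm hΩ hΦ hUo hUO hz
  have P0 : ∀ (f : ℂ → ℂ) (x : ℝ), hcP lam f x = 0 := by
    intro f x; simp [hcP, hcLift, hcG]
  have PI : ∀ (f : ℂ → ℂ), DifferentiableOn ℂ f Ω → ∀ x : ℝ, |x - z₀.re| < ε →
      fderiv ℝ (hcP lam f) x I = f x := by
    intro f hf x hx
    rw [hcP_DI hΩ hf hUo hUO (haxis x hx)]
    simp
  have hmain := hc_unique (lam := lam) (ε := ε) (B := B) (a := z₀.re) hε
    (w := fun z => (u z : ℂ) - (fderiv ℝ (hcP lam Φ) z I + hcP lam Ψ z)) (y := z₀.im)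
    (by rw [hUdef]; exact cu.sub (cΦ.add cΨ)) ?_ ?_ ?_ hB
  · rw [re_add_im] at hmain
    have hz₀U : z₀ ∈ U := by rw [← hUdef]; exact ⟨by simpa using hε, hB⟩
    rw [hcP_DI hΩ hΦ hUo hUO hz₀U] at hmain
    have hz : z₀ = z₀.re + z₀.im * I := (re_add_im z₀).symm
    have hw : (starRingEnd ℂ) z₀ = z₀.re - z₀.im * I := by
      apply Complex.ext <;> simp
    have f1 : (z₀.re : ℂ) + I * z₀.im = z₀ := by rw [mul_comm]; exact re_add_im z₀
    have f2 : (z₀.re : ℂ) - I * z₀.im = (starRingEnd ℂ) z₀ := by rw [hw, mul_comm]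
    have hd : z₀ - (starRingEnd ℂ) z₀ = 2 * z₀.im * I := by
      rw [hw]; linear_combination hz
    have hpt : ∀ t : ℝ, (starRingEnd ℂ) z₀ + (t:ℂ) * (z₀ - (starRingEnd ℂ) z₀)
        = hcPt z₀.re z₀.im t := by
      intro t; rw [hd, hw]; simp only [hcPt]; ring
    have hZ : ∀ t : ℝ, (hcPt z₀.re z₀.im t - z₀) * (hcPt z₀.re z₀.im t - (starRingEnd ℂ) z₀)
        = hcZ z₀.im t := by
      intro t
      rw [← f2]
      nth_rewrite 3 [← f1]
      simp only [hcPt, hcZ]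
      linear_combination (4 * (z₀.im:ℂ)^2 * t * (t - 1)) * I_sq
    rw [f1, f2] at hmain
    have i1 : ∫ t in (0:ℝ)..1, Φ (hcPt z₀.re z₀.im t) * deriv (besselKernel lam) (hcZ z₀.im t)
        = ∫ t in (0:ℝ)..1, deriv (besselKernel lam) (hcZ z₀.im t) * Φ (hcPt z₀.re z₀.im t) := by
      congr 1; ext t; ring
    have i2 : hcP lam Ψ z₀ = z₀.im * ∫ t in (0:ℝ)..1,
        besselKernel lam (hcZ z₀.im t) * Ψ (hcPt z₀.re z₀.im t) := by
      rw [← intervalIntegral.integral_const_mul]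
      simp only [hcP, hcLift, hcG]
      congr 1; ext t; ring
    simp only [segIntegral, hpt, hZ]
    rw [i1, hd]
    rw [i2] at hmain
    linear_combination hmain + (2 * (z₀.im:ℂ)^2 * (∫ t in (0:ℝ)..1,
      deriv (besselKernel lam) (hcZ z₀.im t) * Φ (hcPt z₀.re z₀.im t)) + z₀.im * ∫ t in (0:ℝ)..1,
        besselKernel lam (hcZ z₀.im t) * Ψ (hcPt z₀.re z₀.im t)) * I_sq
  · intro z h1 h2
    have hz : z ∈ U := by rw [← hUdef]; exact ⟨h1, h2⟩
    rw [hc_lap_sub_add hUo cu cΦ cΨ hz]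
    have a1 := lu z hz
    have a2 := hc_lap_DI hUo cΦ3 lΦ0 hz
    have a3 := hcP_helm (lam := lam) hΩ hΨ hUo hUO hz
    linear_combination a1 - a2 - a3
  · intro x hx
    rw [PI Φ hΦ x hx, P0, hbdD x (hUΩ (haxis x hx))]
    ring
  · intro x hx
    have hz := haxis x hx
    have hd : ∀ {k : ℂ → ℂ}, ContDiffOn ℝ 2 k U → DifferentiableAt ℝ k x := fun hk =>
      (hk.contDiffAt (hUo.mem_nhds hz)).differentiableAt (by norm_num)
    have e := congrArg (fun L : ℂ →L[ℝ] ℂ => L I)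
      ((hd cu).hasFDerivAt.sub ((hd cΦ).hasFDerivAt.add (hd cΨ).hasFDerivAt)).fderiv
    refine e.trans ?_
    have b1 : fderiv ℝ (fun z => (u z : ℂ)) x I = Ψ x := by
      have hux : DifferentiableAt ℝ u x :=
        (hu.contDiffAt (hΩ.mem_nhds (hUΩ hz))).differentiableAt (by norm_num)
      rw [hc_ofReal_fderiv hux, hbdN x (hUΩ hz)]
      have hux' : DifferentiableAt ℝ u ((x:ℂ) + (0:ℝ) * I) := by simpa using hux
      rw [(hc_line hux').deriv]
      simp
    have b2 : fderiv ℝ (fun z => fderiv ℝ (hcP lam Φ) z I) x I = 0 := by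
      have h := lΦ0 x hz
      rw [P0] at h
      have h11 : fderiv ℝ (fun z => fderiv ℝ (hcP lam Φ) z 1) x 1 = 0 := by
        have := hcD_int2 (hcO_open hΩ) hUo hUO (hcG_smooth lam hΩ hΦ) hz 1 1
        refine this.trans ?_
        rw [intervalIntegral.integral_congr (g := fun _ => (0:ℂ))]
        · simp
        · intro t ht
          rw [Set.uIcc_of_le zero_le_one] at ht
          simp only
          rw [hcG_D11 hΩ hΦ (hUO _ hz t ht)]
          simp [hcLift, hcG]
      unfold hcLap at h
      rw [h11] at h
      simpa using h
    have b3 := PI Ψ hΨ x hx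
    change fderiv ℝ (fun z => (u z : ℂ)) x I - (fderiv ℝ (fun z => fderiv ℝ (hcP lam Φ) z I) x I
      + fderiv ℝ (hcP lam Ψ) x I) = 0
    rw [b1, b2, b3]
    ring
end

section
/- Let λ ∈ ℝ and define the entire function K : ℂ → ℂ by K(ζ) := Σ_{k=0}^∞ ((−λ²/4)^k/(k!)²)·ζ^k, with complex derivative K'. Let D, D' ⊆ ℂ be open, S holomorphic on D with S(D) ⊆ D', and let u : ℂ × ℂ → ℂ be holomorphic on D × D' (jointly differentiable in the two complex variables) and satisfy ∂²u/∂z∂w + (λ²/4)·u = 0 on D × D'. Let q and ψ be holomorphic on D with q(z)² = S'(z) and (∂u/∂z)(z, S(z)) − (∂u/∂w)(z, S(z))·S'(z) = i·ψ(z)·q(z) for all z ∈ D. Let z₀ ∈ D, w₀ ∈ D', ζ₀ ∈ D with S(ζ₀) = w₀, and assume the straight segment [ζ₀, z₀] is contained in D. Then u(z₀, w₀) = ½·[u(ζ₀, w₀) + u(z₀, S(z₀))] − ½·∫_{[ζ₀,z₀]} u(z, S(z))·K'((z − z₀)·(S(z) − w₀))·[(S(z) − w₀) − S'(z)·(z −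 z₀)] dz + (i/2)·∫_{[ζ₀,z₀]} K((z − z₀)·(S(z) − w₀))·ψ(z)·q(z) dz. -/
open Complex

theorem aux_fderiv_apply_differentiable {U : Set (ℂ × ℂ)} (hU : IsOpen U) {u : ℂ × ℂ → ℂ}
    (hu : DifferentiableOn ℂ u U) (v : ℂ × ℂ) (hv : ‖v‖ ≤ 1) :
    DifferentiableOn ℂ (fun x => fderiv ℂ u x v) U := by
  intro x₀ hx₀
  have hc : ContinuousAt u x₀ := (hu.differentiableAt (hU.mem_nhds hx₀)).continuousAt
  obtain ⟨M, r, hr, hball, hM⟩ : ∃ M r : ℝ, 0 < r ∧ Metric.ball x₀ (4 * r) ⊆ U ∧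
      ∀ y ∈ Metric.ball x₀ (4 * r), ‖u y‖ ≤ M := by
    have h1 : ∀ᶠ y in nhds x₀, y ∈ U ∧ ‖u y‖ < ‖u x₀‖ + 1 :=
      Filter.Eventually.and (hU.mem_nhds hx₀) (hc.norm.eventually_lt_const (by linarith))
    obtain ⟨ε, hε, h2⟩ := Metric.eventually_nhds_iff_ball.1 h1
    refine ⟨‖u x₀‖ + 1, ε / 4, by positivity, ?_, ?_⟩
    · intro y hy
      exact (h2 y (by convert hy using 2; ring)).1
    · intro y hy
      exact (h2 y (by convert hy using 2; ring)).2.le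
  have hdU : ∀ y ∈ Metric.ball x₀ (4 * r), DifferentiableAt ℂ u y := fun y hy =>
    hu.differentiableAt (hU.mem_nhds (hball hy))
  have hM0 : 0 ≤ M := (norm_nonneg _).trans (hM x₀ (Metric.mem_ball_self (by positivity)))
  -- the slices
  have hslice : ∀ (y h : ℂ × ℂ) (t : ℂ), DifferentiableAt ℂ u (y + t • h) →
      HasDerivAt (fun t : ℂ => u (y + t • h)) (fderiv ℂ u (y + t • h) h) t := by
    intro y h t hd
    have h1 : HasDerivAt (fun t : ℂ => y + t • h) h t := by
      simpa using ((hasDerivAt_id t).smul_const h).const_add y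
    exact hd.hasFDerivAt.comp_hasDerivAt t h1
  have hmem : ∀ y ∈ Metric.ball x₀ (2 * r), ∀ h : ℂ × ℂ, ‖h‖ < 2 * r →
      y + h ∈ Metric.ball x₀ (4 * r) := by
    intro y hy h hh
    rw [mem_ball_iff_norm] at hy ⊢
    calc ‖y + h - x₀‖ = ‖(y - x₀) + h‖ := by congr 1; abel
      _ ≤ ‖y - x₀‖ + ‖h‖ := norm_add_le _ _
      _ < 4 * r := by linarith
  have hbound : ∀ y ∈ Metric.ball x₀ (2 * r), ‖fderiv ℂ u y‖ ≤ M / r := by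
    intro y hy
    refine ContinuousLinearMap.opNorm_le_bound _ (by positivity) fun h => ?_
    rcases eq_or_ne h 0 with rfl | hh
    · simp
    have hh' : 0 < ‖h‖ := norm_pos_iff.2 hh
    have hin : ∀ t ∈ Metric.closedBall (0:ℂ) (r / ‖h‖), y + t • h ∈ Metric.ball x₀ (4 * r) := by
      intro t ht
      apply hmem y hy
      rw [norm_smul]
      have : ‖t‖ ≤ r / ‖h‖ := by simpa using ht
      have : ‖t‖ * ‖h‖ ≤ r := by rwa [le_div_iff₀ hh'] at this
      linarith
    have := Complex.norm_deriv_le_of_forall_mem_sphere_norm_le (c := 0) (R := r / ‖h‖) (C := M)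
      (f := fun t : ℂ => u (y + t • h)) (by positivity) ?_ ?_
    · rw [(hslice y h 0 (hdU _ (hin 0 (by simp; positivity)))).deriv] at this
      simp only [zero_smul, add_zero] at this
      calc _ ≤ _ := this
        _ = _ := by field_simp
    · refine DifferentiableOn.diffContOnCl_ball (U := Metric.closedBall (0:ℂ) (r / ‖h‖)) ?_ subset_rfl
      intro t ht
      exact (hslice y h t (hdU _ (hin t ht))).differentiableAt.differentiableWithinAt
    · intro t ht
      exact hM _ (hin t (Metric.sphere_subset_closedBall ht))
  have hcm : ∀ θ, ‖circleMap 0 r θ‖ = r := by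
    intro θ; simp [abs_of_pos hr]
  have hinv : ∀ x ∈ Metric.ball x₀ r, ∀ θ, x + circleMap 0 r θ • v ∈ Metric.ball x₀ (2 * r) := by
    intro x hx θ
    rw [mem_ball_iff_norm] at hx ⊢
    have : ‖circleMap 0 r θ • v‖ ≤ r := by
      rw [norm_smul, hcm]; nlinarith
    calc ‖x + circleMap 0 r θ • v - x₀‖ = ‖(x - x₀) + circleMap 0 r θ • v‖ := by congr 1; abel
      _ ≤ ‖x - x₀‖ + ‖circleMap 0 r θ • v‖ := norm_add_le _ _
      _ < 2 * r := by linarith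
  have h24 : Metric.ball x₀ (2 * r) ⊆ Metric.ball x₀ (4 * r) :=
    Metric.ball_subset_ball (by linarith)
  set c : ℝ → ℂ := fun θ => deriv (circleMap 0 r) θ * ((circleMap 0 r θ) ^ 2)⁻¹ with hcdef
  have hcn : ∀ θ, ‖c θ‖ = r⁻¹ := by
    intro θ
    simp only [hcdef, deriv_circleMap, norm_mul, norm_inv, norm_pow, hcm, norm_I]
    field_simp
  have hccont : Continuous c := by
    simp only [hcdef, deriv_circleMap]
    have : ∀ θ, circleMap 0 r θ ^ 2 ≠ 0 := fun θ => by
      intro h0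
      have : circleMap 0 r θ = 0 := by simpa using h0
      have h2 := hcm θ
      rw [this, norm_zero] at h2
      exact hr.ne h2
    exact ((continuous_circleMap 0 r).mul continuous_const).mul
      (((continuous_circleMap 0 r).pow 2).inv₀ this)
  have hform : ∀ x ∈ Metric.ball x₀ r, fderiv ℂ u x v =
      (2 * Real.pi * I : ℂ)⁻¹ * ∫ θ in (0:ℝ)..2 * Real.pi, c θ * u (x + circleMap 0 r θ • v) := by
    intro x hx
    have hx2 : x ∈ Metric.ball x₀ (2 * r) := Metric.ball_subset_ball (by linarith) hx
    have hin : ∀ t ∈ Metric.ball (0:ℂ) (2 * r), x + t • v ∈ Metric.ball x₀ (4 * r) := by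
      intro t ht
      apply hmem x hx2
      rw [norm_smul]
      have : ‖t‖ < 2 * r := by simpa using ht
      have := norm_nonneg t
      nlinarith [norm_nonneg v]
    have := two_pi_I_inv_smul_circleIntegral_sub_sq_inv_smul_of_differentiable
      (U := Metric.ball (0:ℂ) (2 * r)) Metric.isOpen_ball (c := 0) (w₀ := 0) (R := r)
      (f := fun t : ℂ => u (x + t • v)) (Metric.closedBall_subset_ball (by linarith))
      (fun t ht => (hslice x v t (hdU _ (hin t ht))).differentiableAt.differentiableWithinAt)
      (Metric.mem_ball_self hr)
    rw [(hslice x v 0 (hdU _ (hin 0 (by simp; positivity)))).deriv] at this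
    simp only [zero_smul, add_zero] at this
    rw [← this, circleIntegral, smul_eq_mul]
    congr 1
    refine intervalIntegral.integral_congr fun θ _ => ?_
    simp [hcdef, mul_assoc]
  have hFc : ∀ x ∈ Metric.ball x₀ r, Continuous fun θ => c θ * u (x + circleMap 0 r θ • v) := by
    intro x hx
    refine hccont.mul ?_
    rw [continuous_iff_continuousAt]
    intro θ
    have h1 : ContinuousAt u (x + circleMap 0 r θ • v) := (hdU _ (h24 (hinv x hx θ))).continuousAt
    exact ContinuousAt.comp (f := fun θ => x + circleMap 0 r θ • v) h1
      (continuous_const.add ((continuous_circleMap 0 r).smul continuous_const)).continuousAt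
  have key := intervalIntegral.hasFDerivAt_integral_of_dominated_of_fderiv_le (𝕜 := ℂ)
    (μ := MeasureTheory.volume) (a := 0) (b := 2 * Real.pi) (x₀ := x₀) (s := Metric.ball x₀ r)
    (F := fun x θ => c θ * u (x + circleMap 0 r θ • v))
    (F' := fun x θ => c θ • fderiv ℂ u (x + circleMap 0 r θ • v))
    (bound := fun _ => r⁻¹ * (M / r)) (Metric.ball_mem_nhds x₀ hr) ?_ ?_ ?_ ?_ ?_ ?_
  · refine DifferentiableAt.differentiableWithinAt ?_
    refine DifferentiableAt.congr_of_eventuallyEq (key.differentiableAt.const_mul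
      (2 * Real.pi * I : ℂ)⁻¹) ?_
    filter_upwards [Metric.ball_mem_nhds x₀ hr] with x hx using hform x hx
  · filter_upwards [Metric.ball_mem_nhds x₀ hr] with x hx
    exact (hFc x hx).aestronglyMeasurable
  · exact (hFc x₀ (Metric.mem_ball_self hr)).intervalIntegrable _ _
  · refine AEMeasurable.aestronglyMeasurable (Measurable.aemeasurable ?_)
    refine hccont.measurable.smul ((measurable_fderiv ℂ u).comp ?_)
    exact (continuous_const.add ((continuous_circleMap 0 r).smul continuous_const)).measurable
  · refine Filter.Eventually.of_forall fun θ _ x hx => ?_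
    rw [norm_smul, hcn]
    exact mul_le_mul_of_nonneg_left (hbound _ (hinv x hx θ)) (by positivity)
  · exact intervalIntegrable_const
  · refine Filter.Eventually.of_forall fun θ _ x hx => ?_
    have h1 := (hdU _ (h24 (hinv x hx θ))).hasFDerivAt
    have h2 : HasFDerivAt (fun x => x + circleMap 0 r θ • v) (ContinuousLinearMap.id ℂ (ℂ × ℂ)) x :=
      (hasFDerivAt_id x).add_const _
    have h3 := (h1.comp x h2).const_mul (c θ)
    simpa using h3

theorem aux_pow_series (a : ℕ → ℂ) (M : ℝ) (hM : 0 ≤ M)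
    (ha : ∀ n : ℕ, ‖(n : ℂ) * a n‖ ≤ M ^ n / n.factorial) (x : ℂ) :
    HasDerivAt (fun z => ∑' n, a n * z ^ n) (∑' n : ℕ, a n * (n * x ^ (n - 1))) x ∧
      Summable (fun n : ℕ => a n * (n * x ^ (n - 1))) := by
  set ρ : ℝ := ‖x‖ + 1 with hρ
  have hρ1 : 1 ≤ ρ := by have := norm_nonneg x; linarith
  have hx : x ∈ Metric.ball (0:ℂ) ρ := by simp [hρ]
  have hs : Summable (fun n : ℕ => (M * ρ) ^ n / n.factorial) :=
    Real.summable_pow_div_factorial _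
  have hb : ∀ (n : ℕ) (y : ℂ), y ∈ Metric.ball (0:ℂ) ρ →
      ‖a n * (n * y ^ (n - 1))‖ ≤ (M * ρ) ^ n / n.factorial := by
    intro n y hy
    have hy' : ‖y‖ ≤ ρ := by
      have : ‖y‖ < ρ := by simpa using hy
      exact this.le
    have h1 : ‖y‖ ^ (n - 1) ≤ ρ ^ n :=
      (pow_le_pow_left₀ (norm_nonneg _) hy' _).trans (pow_le_pow_right₀ hρ1 (Nat.sub_le _ _))
    calc ‖a n * (n * y ^ (n - 1))‖ = ‖(n : ℂ) * a n‖ * ‖y‖ ^ (n - 1) := by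
          simp only [norm_mul, norm_pow]; ring
      _ ≤ (M ^ n / n.factorial) * ρ ^ n := by
          apply mul_le_mul (ha n) h1 (by positivity) (by positivity)
      _ = _ := by rw [mul_pow]; ring
  refine ⟨?_, Summable.of_norm_bounded hs fun n => hb n x hx⟩
  refine hasDerivAt_tsum_of_isPreconnected (y₀ := 0) hs Metric.isOpen_ball
    (convex_ball (0:ℂ) ρ).isPreconnected
    (fun n y _ => (hasDerivAt_pow n y).const_mul (a n)) hb ?_ ?_ hx
  · simp only [Metric.mem_ball, dist_self]; linarith
  · refine summable_of_ne_finset_zero (s := {0}) fun n hn => ?_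
    have : n ≠ 0 := by simpa using hn
    simp [this]

theorem aux_bessel (lam : ℝ) : Differentiable ℂ (besselKernel lam) ∧
    ∀ x, HasDerivAt (fun x => x * deriv (besselKernel lam) x)
      (-((lam : ℂ) ^ 2 / 4) * besselKernel lam x) x := by
  set c : ℂ := -(lam : ℂ) ^ 2 / 4 with hc
  set a : ℕ → ℂ := fun n => c ^ n / ((n.factorial : ℂ)) ^ 2 with ha
  have hbd : ∀ n : ℕ, (n : ℝ) ^ 2 * ‖a n‖ ≤ (4 * ‖c‖) ^ n / n.factorial := by
    intro n
    simp only [ha, norm_div, norm_pow, Complex.norm_natCast]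
    have h1 : (n : ℝ) ≤ 2 ^ n := by exact_mod_cast (Nat.lt_two_pow_self (n := n)).le
    have h2 : (n : ℝ) ^ 2 ≤ 4 ^ n := by
      calc (n : ℝ) ^ 2 ≤ (2 ^ n) ^ 2 := pow_le_pow_left₀ (by positivity) h1 2
        _ = 4 ^ n := by rw [← pow_mul, mul_comm, pow_mul]; norm_num
    have h3 : (1 : ℝ) ≤ n.factorial := by exact_mod_cast Nat.succ_le_of_lt n.factorial_pos
    calc (n : ℝ) ^ 2 * (‖c‖ ^ n / (n.factorial : ℝ) ^ 2)
        ≤ 4 ^ n * (‖c‖ ^ n / (n.factorial : ℝ)) := by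
          gcongr
          nlinarith
      _ = _ := by rw [mul_pow]; ring
  have hK : ∀ x, HasDerivAt (besselKernel lam) (∑' n : ℕ, a n * (n * x ^ (n - 1))) x ∧
      Summable (fun n : ℕ => a n * (n * x ^ (n - 1))) := by
    refine aux_pow_series a (4 * ‖c‖) (by positivity) fun n => ?_
    refine le_trans ?_ (hbd n)
    rw [norm_mul, Complex.norm_natCast]
    refine mul_le_mul_of_nonneg_right ?_ (norm_nonneg _)
    rcases n with _ | n
    · simp
    · push_cast; nlinarith [(Nat.cast_nonneg n : (0:ℝ) ≤ n)]
  refine ⟨fun x => (hK x).1.differentiableAt, fun x => ?_⟩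
  have h2 := aux_pow_series (fun n => n * a n) (4 * ‖c‖) (by positivity) (fun n => by
    refine le_trans (le_of_eq ?_) (hbd n)
    rw [norm_mul, norm_mul, Complex.norm_natCast]; ring) x
  have hfun : (fun x => x * deriv (besselKernel lam) x) = fun z => ∑' n : ℕ, n * a n * z ^ n := by
    funext z
    rw [(hK z).1.deriv, ← tsum_mul_left]
    refine tsum_congr fun n => ?_
    rcases n with _ | n
    · simp
    · simp only [Nat.add_sub_cancel, pow_succ]; ring
  rw [hfun]
  convert h2.1 using 1
  rw [h2.2.tsum_eq_zero_add]
  have hcc : -((lam : ℂ) ^ 2 / 4) = c := by rw [hc]; ring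
  simp only [Nat.cast_zero, zero_mul, mul_zero, zero_add, Nat.add_sub_cancel]
  rw [hcc, besselKernel, ← tsum_mul_left]
  refine tsum_congr fun n => ?_
  have h3 : (n.factorial : ℂ) ≠ 0 := by exact_mod_cast n.factorial_ne_zero
  have h4 : ((n + 1 : ℕ) : ℂ) ≠ 0 := by exact_mod_cast n.succ_ne_zero
  simp only [ha, Nat.factorial_succ, Nat.cast_mul]
  rw [← hc]
  field_simp
  ring

theorem aux_slice1 {f : ℂ × ℂ → ℂ} {z w : ℂ} (hf : DifferentiableAt ℂ f (z, w)) :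
    HasDerivAt (fun z' => f (z', w)) (fderiv ℂ f (z, w) (1, 0)) z :=
  hf.hasFDerivAt.comp_hasDerivAt z ((hasDerivAt_id z).prodMk (hasDerivAt_const z w))

theorem aux_slice2 {f : ℂ × ℂ → ℂ} {z w : ℂ} (hf : DifferentiableAt ℂ f (z, w)) :
    HasDerivAt (fun w' => f (z, w')) (fderiv ℂ f (z, w) (0, 1)) w :=
  hf.hasFDerivAt.comp_hasDerivAt w ((hasDerivAt_const w z).prodMk (hasDerivAt_id w))

theorem aux_fderiv_eq (L : ℂ × ℂ →L[ℂ] ℂ) (h : ℂ × ℂ) : L h = L (1, 0) * h.1 + L (0, 1) * h.2 := by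
  have : h = h.1 • ((1, 0) : ℂ × ℂ) + h.2 • ((0, 1) : ℂ × ℂ) := by ext <;> simp
  conv_lhs => rw [this, map_add, map_smul, map_smul]
  simp [mul_comm]

theorem aux_symm {U : Set (ℂ × ℂ)} (hU : IsOpen U) {u : ℂ × ℂ → ℂ}
    (hu : DifferentiableOn ℂ u U) {x : ℂ × ℂ} (hx : x ∈ U) :
    fderiv ℂ (fun y => fderiv ℂ u y (0, 1)) x (1, 0) =
      fderiv ℂ (fun y => fderiv ℂ u y (1, 0)) x (0, 1) := by
  have hA := (aux_fderiv_apply_differentiable hU hu (1, 0) (by simp)).differentiableAt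
    (hU.mem_nhds hx)
  have hB := (aux_fderiv_apply_differentiable hU hu (0, 1) (by simp)).differentiableAt
    (hU.mem_nhds hx)
  have hfd : HasFDerivAt (fderiv ℂ u)
      ((fderiv ℂ (fun y => fderiv ℂ u y (1, 0)) x).smulRight (ContinuousLinearMap.fst ℂ ℂ ℂ) +
       (fderiv ℂ (fun y => fderiv ℂ u y (0, 1)) x).smulRight (ContinuousLinearMap.snd ℂ ℂ ℂ)) x := by
    have h1 := (hA.hasFDerivAt.smul_const (ContinuousLinearMap.fst ℂ ℂ ℂ)).add
      (hB.hasFDerivAt.smul_const (ContinuousLinearMap.snd ℂ ℂ ℂ))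
    refine h1.congr_of_eventuallyEq (Filter.Eventually.of_forall fun y => ?_)
    ext <;> simp
  have := second_derivative_symmetric_of_eventually (𝕜 := ℂ) (f := u) (f' := fderiv ℂ u) (x := x)
    (by filter_upwards [hU.mem_nhds hx] with y hy
        exact (hu.differentiableAt (hU.mem_nhds hy)).hasFDerivAt) hfd (1, 0) (0, 1)
  simpa using this

theorem aux_potential {U : Set (ℂ × ℂ)} (hU : IsOpen U) (hUc : Convex ℝ U) {V R : ℂ × ℂ → ℂ}
    (hV : DifferentiableOn ℂ V U) (hR : DifferentiableOn ℂ R U) (κ : ℂ × ℂ → ℂ)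
    (hVe : ∀ x ∈ U, fderiv ℂ (fun y => fderiv ℂ V y (1, 0)) x (0, 1) = κ x * V x)
    (hRe : ∀ x ∈ U, fderiv ℂ (fun y => fderiv ℂ R y (1, 0)) x (0, 1) = κ x * R x) :
    ∃ f : ℂ × ℂ → ℂ, ∀ x ∈ U, HasFDerivAt f
      ((R x * fderiv ℂ V x (1, 0) - V x * fderiv ℂ R x (1, 0)) • ContinuousLinearMap.fst ℂ ℂ ℂ +
       (V x * fderiv ℂ R x (0, 1) - R x * fderiv ℂ V x (0, 1)) • ContinuousLinearMap.snd ℂ ℂ ℂ) x := by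
  set p : ℂ × ℂ → ℂ := fun x => R x * fderiv ℂ V x (1, 0) - V x * fderiv ℂ R x (1, 0) with hp
  set m : ℂ × ℂ → ℂ := fun x => V x * fderiv ℂ R x (0, 1) - R x * fderiv ℂ V x (0, 1) with hm
  have key : ∀ x ∈ U, ∃ p' m' : ℂ × ℂ →L[ℂ] ℂ, HasFDerivAt p p' x ∧ HasFDerivAt m m' x ∧
      p' (0, 1) = m' (1, 0) := by
    intro x hx
    have hn := hU.mem_nhds hx
    have dV := (hV.differentiableAt hn).hasFDerivAt
    have dR := (hR.differentiableAt hn).hasFDerivAt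
    have dV1 := ((aux_fderiv_apply_differentiable hU hV (1, 0) (by simp)).differentiableAt
      hn).hasFDerivAt
    have dV2 := ((aux_fderiv_apply_differentiable hU hV (0, 1) (by simp)).differentiableAt
      hn).hasFDerivAt
    have dR1 := ((aux_fderiv_apply_differentiable hU hR (1, 0) (by simp)).differentiableAt
      hn).hasFDerivAt
    have dR2 := ((aux_fderiv_apply_differentiable hU hR (0, 1) (by simp)).differentiableAt
      hn).hasFDerivAt
    refine ⟨_, _, (dR.mul dV1).sub (dV.mul dR1), (dV.mul dR2).sub (dR.mul dV2), ?_⟩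
    simp only [_root_.sub_apply, _root_.add_apply,
      _root_.smul_apply, smul_eq_mul]
    rw [aux_symm hU hV hx, aux_symm hU hR hx, hVe x hx, hRe x hx]
    ring
  choose! p' m' hp' hm' hpm using key
  obtain ⟨f, hf⟩ := hUc.exists_forall_hasFDerivWithinAt_of_hasFDerivWithinAt_symmetric
    (𝕜 := ℂ) (F := ℂ)
    (ω := fun x => p x • ContinuousLinearMap.fst ℂ ℂ ℂ + m x • ContinuousLinearMap.snd ℂ ℂ ℂ)
    (dω := fun x => ContinuousLinearMap.restrictScalars ℝ
      ((p' x).smulRight (ContinuousLinearMap.fst ℂ ℂ ℂ) +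
        (m' x).smulRight (ContinuousLinearMap.snd ℂ ℂ ℂ)))
    (fun x hx => by
      have h1 := ((hp' x hx).smul_const (ContinuousLinearMap.fst ℂ ℂ ℂ)).add
        ((hm' x hx).smul_const (ContinuousLinearMap.snd ℂ ℂ ℂ))
      exact (h1.restrictScalars ℝ).hasFDerivWithinAt)
    (fun x hx h _ k _ => by
      simp only [ContinuousLinearMap.coe_restrictScalars', _root_.add_apply,
        ContinuousLinearMap.smulRight_apply, _root_.smul_apply,
        ContinuousLinearMap.coe_fst', ContinuousLinearMap.coe_snd', smul_eq_mul]
      rw [aux_fderiv_eq (p' x) h, aux_fderiv_eq (m' x) h, aux_fderiv_eq (p' x) k,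
        aux_fderiv_eq (m' x) k, hpm x hx]
      ring)
  exact ⟨f, fun x hx => (hf x hx).hasFDerivAt (hU.mem_nhds hx)⟩

theorem aux_seg {C : Set ℂ} (hCc : Convex ℝ C) {F g : ℂ → ℂ}
    (hF : ∀ z ∈ C, HasDerivAt F (g z) z) (hg : ContinuousOn g C) {a b : ℂ} (ha : a ∈ C)
    (hb : b ∈ C) : segIntegral g a b = F b - F a := by
  have hmem : ∀ t ∈ Set.uIcc (0:ℝ) 1, a + (t : ℂ) * (b - a) ∈ C := by
    intro t ht
    rw [Set.uIcc_of_le zero_le_one] at ht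
    have := hCc.add_smul_sub_mem ha hb ht
    simpa using this
  have hl : ∀ t : ℝ, HasDerivAt (fun t : ℝ => a + (t : ℂ) * (b - a)) (b - a) t := by
    intro t
    have h1 : HasDerivAt (fun t : ℝ => (t : ℂ)) 1 t := (hasDerivAt_id t).ofReal_comp
    simpa using (h1.mul_const (b - a)).const_add a
  have hcl : Continuous fun t : ℝ => a + (t : ℂ) * (b - a) :=
    continuous_iff_continuousAt.2 fun t => (hl t).continuousAt
  have := intervalIntegral.integral_eq_sub_of_hasDerivAt (a := 0) (b := 1)
    (f := fun t : ℝ => F (a + (t : ℂ) * (b - a)))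
    (f' := fun t : ℝ => (b - a) * g (a + (t : ℂ) * (b - a)))
    (fun t ht => by
      have h := (hF _ (hmem t ht)).comp_of_eq t (hl t) rfl
      rw [mul_comm]
      exact h)
    (ContinuousOn.intervalIntegrable
      (continuousOn_const.mul (hg.comp hcl.continuousOn hmem)))
  rw [segIntegral, ← intervalIntegral.integral_const_mul, this]
  simp

theorem aux_unique {C : Set ℂ} (hCc : Convex ℝ C) {F G g : ℂ → ℂ}
    (hF : ∀ z ∈ C, HasDerivAt F (g z) z) (hG : ∀ z ∈ C, HasDerivAt G (g z) z)
    {a b : ℂ} (ha : a ∈ C) (hb : b ∈ C) : F b - F a = G b - G a := by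
  have := aux_seg hCc (F := fun z => F z - G z) (g := fun _ => 0)
    (fun z hz => by
      have h := (hF z hz).sub (hG z hz)
      rw [sub_self] at h
      exact h) continuousOn_const ha hb
  simp [segIntegral] at this
  linear_combination -this

/-- Complexified form of the representation of solutions of the Cauchy problem
for the Helmholtz equation (formula (CRH)): `u` solves
`∂²u/∂z∂w + (λ²/4)u = 0` near the complexified curve `{w = S(z)}` (`S` the
Schwarz function, `ζ₀ = S̃(w₀)`, `q` a branch of `√(S')`), with Dirichlet datum
`φ(z) = u(z,S(z))` and Neumann datum encoded by `ψ`. -/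
theorem helmholtz_cauchy_representation
    (lam : ℝ) (D D' : Set ℂ) (hD : IsOpen D) (hD' : IsOpen D')
    (S : ℂ → ℂ) (hS : DifferentiableOn ℂ S D) (hSD : S '' D ⊆ D')
    (u : ℂ × ℂ → ℂ) (hu : DifferentiableOn ℂ u (D ×ˢ D'))
    (hhelm : ∀ z ∈ D, ∀ w ∈ D',
      deriv (fun w' => deriv (fun z' => u (z', w')) z) w
        + ((lam : ℂ) ^ 2 / 4) * u (z, w) = 0)
    (q ψ : ℂ → ℂ)
    (hq : DifferentiableOn ℂ q D) (hψ : DifferentiableOn ℂ ψ D)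
    (hq2 : ∀ z ∈ D, (q z) ^ 2 = deriv S z)
    (hneu : ∀ z ∈ D,
      deriv (fun z' => u (z', S z)) z
        - deriv (fun w' => u (z, w')) (S z) * deriv S z = I * ψ z * q z)
    (z₀ : ℂ) (hz₀ : z₀ ∈ D) (w₀ : ℂ) (hw₀ : w₀ ∈ D')
    (ζ₀ : ℂ) (hζ₀ : ζ₀ ∈ D) (hSζ₀ : S ζ₀ = w₀)
    (hseg : segment ℝ ζ₀ z₀ ⊆ D) :
    u (z₀, w₀) =
      (1/2) * (u (ζ₀, w₀) + u (z₀, S z₀))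
        - (1/2) *
            segIntegral
              (fun z => u (z, S z) *
                deriv (besselKernel lam) ((z - z₀) * (S z - w₀)) *
                ((S z - w₀) - deriv S z * (z - z₀)))
              ζ₀ z₀
        + (I/2) *
            segIntegral
              (fun z => besselKernel lam ((z - z₀) * (S z - w₀)) * ψ z * q z)
              ζ₀ z₀ := by
  obtain ⟨δ, hδ, hδD⟩ := IsCompact.exists_thickening_subset_open
    (s := segment ℝ ζ₀ z₀) (t := D) (by
      rw [segment_eq_image_lineMap]
      exact isCompact_Icc.image AffineMap.lineMap_continuous) hD hseg
  set C : Set ℂ := Metric.thickening δ (segment ℝ ζ₀ z₀) with hCdef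
  have hC : IsOpen C := Metric.isOpen_thickening
  have hCc : Convex ℝ C := (convex_segment ζ₀ z₀).thickening δ
  have hsC : segment ℝ ζ₀ z₀ ⊆ C := Metric.self_subset_thickening hδ _
  have hζC : ζ₀ ∈ C := hsC (left_mem_segment ℝ ζ₀ z₀)
  have hzC : z₀ ∈ C := hsC (right_mem_segment ℝ ζ₀ z₀)
  have hU : IsOpen (C ×ˢ C) := hC.prod hC
  have hUc : Convex ℝ (C ×ˢ C) := hCc.prod hCc
  have hDD : IsOpen (D ×ˢ D') := hD.prod hD'
  have hSm : ∀ z ∈ C, S z ∈ D' := fun z hz => hSD ⟨z, hδD hz, rfl⟩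
  have hSd : ∀ z ∈ C, HasDerivAt S (deriv S z) z := fun z hz =>
    (hS.differentiableAt (hD.mem_nhds (hδD hz))).hasDerivAt
  have hud : ∀ z ∈ D, ∀ w ∈ D', DifferentiableAt ℂ u (z, w) := fun z hz w hw =>
    hu.differentiableAt (hDD.mem_nhds ⟨hz, hw⟩)
  obtain ⟨hK, hK2⟩ := aux_bessel lam
  set K := besselKernel lam with hKdef
  have hK' : Differentiable ℂ (deriv K) := by
    rw [← differentiableOn_univ]
    exact hK.differentiableOn.deriv isOpen_univ
  have hK0 : K 0 = 1 := by
    rw [hKdef, besselKernel, tsum_eq_single 0 (fun n hn => by simp [hn])]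
    simp
  have hode : ∀ x, deriv K x + x * deriv (deriv K) x = -((lam : ℂ) ^ 2 / 4) * K x := by
    intro x
    have h1 := (hasDerivAt_id x).mul (hK' x).hasDerivAt
    have h2 := h1.unique (hK2 x)
    simpa using h2
  set V : ℂ × ℂ → ℂ := fun x => u (x.1, S x.2) with hVdef
  set R : ℂ × ℂ → ℂ := fun x => K ((x.1 - z₀) * (S x.2 - w₀)) with hRdef
  have hSnd : ∀ x ∈ C ×ˢ C, DifferentiableAt ℂ (fun x : ℂ × ℂ => S x.2) x := fun x hx =>
    (hSd x.2 hx.2).differentiableAt.comp x differentiableAt_snd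
  have hVd : ∀ x ∈ C ×ˢ C, DifferentiableAt ℂ V x := by
    intro x hx
    exact (hud x.1 (hδD hx.1) (S x.2) (hSm _ hx.2)).comp x
      (f := fun x : ℂ × ℂ => (x.1, S x.2)) (differentiableAt_fst.prodMk (hSnd x hx))
  have hRd : ∀ x ∈ C ×ˢ C, DifferentiableAt ℂ R x := by
    intro x hx
    exact (hK _).comp x (f := fun x : ℂ × ℂ => (x.1 - z₀) * (S x.2 - w₀))
      ((differentiableAt_fst.sub_const _).mul ((hSnd x hx).sub_const _))
  have hVU : DifferentiableOn ℂ V (C ×ˢ C) := fun x hx => (hVd x hx).differentiableWithinAt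
  have hRU : DifferentiableOn ℂ R (C ×ˢ C) := fun x hx => (hRd x hx).differentiableWithinAt
  -- first derivatives
  have hV1 : ∀ z ∈ C, ∀ ζ ∈ C, fderiv ℂ V (z, ζ) (1, 0) = fderiv ℂ u (z, S ζ) (1, 0) := by
    intro z hz ζ hζ
    exact (aux_slice1 (hVd (z, ζ) ⟨hz, hζ⟩)).unique
      (aux_slice1 (hud z (hδD hz) (S ζ) (hSm _ hζ)))
  have hV2 : ∀ z ∈ C, ∀ ζ ∈ C,
      fderiv ℂ V (z, ζ) (0, 1) = fderiv ℂ u (z, S ζ) (0, 1) * deriv S ζ := by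
    intro z hz ζ hζ
    exact (aux_slice2 (hVd (z, ζ) ⟨hz, hζ⟩)).unique
      ((aux_slice2 (hud z (hδD hz) (S ζ) (hSm _ hζ))).comp ζ (hSd ζ hζ))
  have hR1 : ∀ z ∈ C, ∀ ζ ∈ C, fderiv ℂ R (z, ζ) (1, 0) =
      deriv K ((z - z₀) * (S ζ - w₀)) * (S ζ - w₀) := by
    intro z hz ζ hζ
    have h1 : HasDerivAt (fun z' => (z' - z₀) * (S ζ - w₀)) (S ζ - w₀) z := by
      simpa using ((hasDerivAt_id z).sub_const z₀).mul_const (S ζ - w₀)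
    exact (aux_slice1 (hRd (z, ζ) ⟨hz, hζ⟩)).unique ((hK _).hasDerivAt.comp z h1)
  have hinner2 : ∀ z, ∀ ζ ∈ C,
      HasDerivAt (fun ζ' => (z - z₀) * (S ζ' - w₀)) ((z - z₀) * deriv S ζ) ζ := fun z ζ hζ =>
    ((hSd ζ hζ).sub_const w₀).const_mul (z - z₀)
  have hR2 : ∀ z ∈ C, ∀ ζ ∈ C, fderiv ℂ R (z, ζ) (0, 1) =
      deriv K ((z - z₀) * (S ζ - w₀)) * ((z - z₀) * deriv S ζ) := by
    intro z hz ζ hζ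
    exact (aux_slice2 (hRd (z, ζ) ⟨hz, hζ⟩)).unique
      ((hK _).hasDerivAt.comp ζ (hinner2 z ζ hζ))
  -- mixed second derivatives
  have hVe : ∀ x ∈ C ×ˢ C, fderiv ℂ (fun y => fderiv ℂ V y (1, 0)) x (0, 1) =
      (-((lam : ℂ) ^ 2 / 4) * deriv S x.2) * V x := by
    rintro ⟨z, ζ⟩ ⟨hz, hζ⟩
    have h1 := aux_slice2 ((aux_fderiv_apply_differentiable hU hVU (1, 0)
      (by simp)).differentiableAt (hU.mem_nhds (x := (z, ζ)) ⟨hz, hζ⟩))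
    have h2 := aux_slice2 ((aux_fderiv_apply_differentiable hDD hu (1, 0)
      (by simp)).differentiableAt (hDD.mem_nhds (x := (z, S ζ)) ⟨hδD hz, hSm ζ hζ⟩))
    have h3 : fderiv ℂ (fun y => fderiv ℂ u y (1, 0)) (z, S ζ) (0, 1) =
        -((lam : ℂ) ^ 2 / 4) * u (z, S ζ) := by
      have h4 := hhelm z (hδD hz) (S ζ) (hSm ζ hζ)
      have h5 : (fun w' => deriv (fun z' => u (z', w')) z) =ᶠ[nhds (S ζ)]
          fun w' => fderiv ℂ u (z, w') (1, 0) := by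
        filter_upwards [hD'.mem_nhds (hSm ζ hζ)] with w hw
        exact (aux_slice1 (hud z (hδD hz) w hw)).deriv
      rw [h5.deriv_eq, h2.deriv] at h4
      linear_combination h4
    have h6 := h2.comp ζ (hSd ζ hζ)
    have h7 : HasDerivAt (fun ζ' => fderiv ℂ V (z, ζ') (1, 0))
        (fderiv ℂ (fun y => fderiv ℂ u y (1, 0)) (z, S ζ) (0, 1) * deriv S ζ) ζ := by
      refine h6.congr_of_eventuallyEq ?_
      filter_upwards [hC.mem_nhds hζ] with ζ' hζ'
      exact hV1 z hz ζ' hζ'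
    rw [h1.unique h7, h3]
    simp only [hVdef]
    ring
  have hRe : ∀ x ∈ C ×ˢ C, fderiv ℂ (fun y => fderiv ℂ R y (1, 0)) x (0, 1) =
      (-((lam : ℂ) ^ 2 / 4) * deriv S x.2) * R x := by
    rintro ⟨z, ζ⟩ ⟨hz, hζ⟩
    have h1 := aux_slice2 ((aux_fderiv_apply_differentiable hU hRU (1, 0)
      (by simp)).differentiableAt (hU.mem_nhds (x := (z, ζ)) ⟨hz, hζ⟩))
    have h6 := (((hK' _).hasDerivAt.comp ζ (hinner2 z ζ hζ))).mul ((hSd ζ hζ).sub_const w₀)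
    have h7 := h6.congr_of_eventuallyEq (f₁ := fun ζ' => fderiv ℂ R (z, ζ') (1, 0)) (by
      filter_upwards [hC.mem_nhds hζ] with ζ' hζ'
      exact hR1 z hz ζ' hζ')
    rw [h1.unique h7]
    simp only [hRdef, Function.comp_apply]
    linear_combination deriv S ζ * hode ((z - z₀) * (S ζ - w₀))
  obtain ⟨f, hf⟩ := aux_potential hU hUc hVU hRU
    (fun x => -((lam : ℂ) ^ 2 / 4) * deriv S x.2) hVe hRe
  -- horizontal side
  have hA : f (z₀, ζ₀) - f (ζ₀, ζ₀) = V (z₀, ζ₀) - V (ζ₀, ζ₀) := by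
    refine aux_unique hCc (F := fun z => f (z, ζ₀)) (G := fun z => V (z, ζ₀))
      (g := fun z => fderiv ℂ V (z, ζ₀) (1, 0)) (fun z hz => ?_)
      (fun z hz => aux_slice1 (hVd (z, ζ₀) ⟨hz, hζC⟩)) hζC hzC
    have h1 := hf (z, ζ₀) ⟨hz, hζC⟩
    have h2 := aux_slice1 h1.differentiableAt
    rw [h1.fderiv] at h2
    convert h2 using 1
    have h3 : R (z, ζ₀) = 1 := by simp [hRdef, hSζ₀, hK0]
    rw [hR1 z hz ζ₀ hζC, h3]
    simp [hSζ₀]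
  have hB : f (z₀, z₀) - f (z₀, ζ₀) = -V (z₀, z₀) - -V (z₀, ζ₀) := by
    refine aux_unique hCc (F := fun ζ => f (z₀, ζ)) (G := fun ζ => -V (z₀, ζ))
      (g := fun ζ => -fderiv ℂ V (z₀, ζ) (0, 1)) (fun ζ hζ => ?_)
      (fun ζ hζ => (aux_slice2 (hVd (z₀, ζ) ⟨hzC, hζ⟩)).neg) hζC hzC
    have h1 := hf (z₀, ζ) ⟨hzC, hζ⟩
    have h2 := aux_slice2 h1.differentiableAt
    rw [h1.fderiv] at h2
    convert h2 using 1
    have h3 : R (z₀, ζ) = 1 := by simp [hRdef, hK0]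
    rw [hR2 z₀ hzC ζ hζ, h3]
    simp
  -- the curve
  set g₁ : ℂ → ℂ := fun z => u (z, S z) * deriv K ((z - z₀) * (S z - w₀)) *
    ((S z - w₀) - deriv S z * (z - z₀)) with hg₁
  set g₂ : ℂ → ℂ := fun z => K ((z - z₀) * (S z - w₀)) * ψ z * q z with hg₂
  have hSC : DifferentiableOn ℂ S C := hS.mono hδD
  have hS'C : DifferentiableOn ℂ (deriv S) C := hSC.deriv hC
  have hX : DifferentiableOn ℂ (fun z => (z - z₀) * (S z - w₀)) C :=
    (differentiableOn_id.sub_const _).mul (hSC.sub_const _)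
  have hdiag : DifferentiableOn ℂ (fun z => u (z, S z)) C := by
    intro z hz
    refine DifferentiableAt.differentiableWithinAt ?_
    exact (hud z (hδD hz) (S z) (hSm _ hz)).comp z (f := fun z => (z, S z))
      (differentiableAt_id.prodMk (hSd z hz).differentiableAt)
  have hg₁d : DifferentiableOn ℂ g₁ C :=
    (hdiag.mul (hK'.comp_differentiableOn hX)).mul
      ((hSC.sub_const _).sub (hS'C.mul (differentiableOn_id.sub_const _)))
  have hg₂d : DifferentiableOn ℂ g₂ C :=
    ((hK.comp_differentiableOn hX).mul (hψ.mono hδD)).mul (hq.mono hδD)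
  obtain ⟨F₁, hF₁'⟩ := hCc.exists_forall_hasDerivWithinAt hg₁d
  obtain ⟨F₂, hF₂'⟩ := hCc.exists_forall_hasDerivWithinAt hg₂d
  have hF₁ : ∀ z ∈ C, HasDerivAt F₁ (g₁ z) z := fun z hz =>
    (hF₁' z hz).hasDerivAt (hC.mem_nhds hz)
  have hF₂ : ∀ z ∈ C, HasDerivAt F₂ (g₂ z) z := fun z hz =>
    (hF₂' z hz).hasDerivAt (hC.mem_nhds hz)
  have hE : f (z₀, z₀) - f (ζ₀, ζ₀) = (I * F₂ z₀ - F₁ z₀) - (I * F₂ ζ₀ - F₁ ζ₀) := by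
    refine aux_unique hCc (F := fun z => f (z, z)) (G := fun z => I * F₂ z - F₁ z)
      (g := fun z => I * g₂ z - g₁ z) (fun z hz => ?_)
      (fun z hz => ((hF₂ z hz).const_mul I).sub (hF₁ z hz)) hζC hzC
    have h1 := hf (z, z) ⟨hz, hz⟩
    have h2 : HasDerivAt (fun z => f (z, z)) _ z :=
      HasFDerivAt.comp_hasDerivAt (f := fun z : ℂ => (z, z)) z h1 ((hasDerivAt_id z).prodMk (hasDerivAt_id z))
    convert h2 using 1
    have h3 := hneu z (hδD hz)
    have h4 := hud z (hδD hz) (S z) (hSm z hz)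
    rw [(aux_slice1 h4).deriv, (aux_slice2 h4).deriv] at h3
    simp only [_root_.add_apply, _root_.smul_apply,
      ContinuousLinearMap.coe_fst', ContinuousLinearMap.coe_snd', smul_eq_mul, mul_one]
    rw [hR1 z hz z hz, hR2 z hz z hz, hV1 z hz z hz, hV2 z hz z hz]
    simp only [hg₁, hg₂, hRdef, hVdef]
    linear_combination -K ((z - z₀) * (S z - w₀)) * h3
  rw [aux_seg hCc hF₁ hg₁d.continuousOn hζC hzC, aux_seg hCc hF₂ hg₂d.continuousOn hζC hzC]
  simp only [hVdef, hSζ₀] at hA hB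
  linear_combination (1 / 2) * hE - (1 / 2) * hA - (1 / 2) * hB
end

section
/- Let Ω ⊆ ℂ be open, connected, symmetric under complex conjugation, with Ω ∩ ℝ ≠ ∅. Let F be holomorphic on Ω and set u := Re F. Let Φ, Ψ be holomorphic on Ω such that for every real x ∈ Ω: Φ(x) = u(x) and Ψ(x) equals the derivative at t = 0 of t ↦ u(x + i·t). Then for every z₀ ∈ Ω such that the straight segment [conj z₀, z₀] is contained in Ω: u(z₀) = (Φ(z₀) + Φ(conj z₀))/2 − (i/2)·∫_{[conj z₀, z₀]} Ψ(ζ) dζ. -/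
open Complex

/-- Identity theorem from the real points. -/
theorem eqOn_of_real_aux (Ω : Set ℂ) (hΩ : IsOpen Ω) (hconn : IsConnected Ω)
    (hreal : ∃ x : ℝ, (x : ℂ) ∈ Ω) (f g : ℂ → ℂ)
    (hf : DifferentiableOn ℂ f Ω) (hg : DifferentiableOn ℂ g Ω)
    (h : ∀ x : ℝ, (x : ℂ) ∈ Ω → f x = g x) : Set.EqOn f g Ω := by
  obtain ⟨x, hx⟩ := hreal
  refine (hf.analyticOnNhd hΩ).eqOn_of_preconnected_of_frequently_eq (hg.analyticOnNhd hΩ)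
    hconn.isPreconnected hx ?_
  have hev : ∀ᶠ y : ℝ in nhdsWithin x {x}ᶜ, f y = g y := by
    have : ∀ᶠ y : ℝ in nhds x, (y : ℂ) ∈ Ω :=
      Complex.continuous_ofReal.continuousAt.eventually (hΩ.mem_nhds hx)
    exact (this.filter_mono nhdsWithin_le_nhds).mono fun y hy => h y hy
  have ht : Filter.Tendsto (fun y : ℝ => (y : ℂ)) (nhdsWithin x {x}ᶜ)
      (nhdsWithin (x : ℂ) {(x : ℂ)}ᶜ) := by
    refine tendsto_nhdsWithin_iff.2 ⟨?_, ?_⟩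
    · exact (Complex.continuous_ofReal.tendsto x).mono_left nhdsWithin_le_nhds
    · filter_upwards [self_mem_nhdsWithin] with y hy
      simpa using hy
  exact ht.frequently hev.frequently

/-- The representation formula (CR) of Theorem 1 (solution of the Cauchy
problem for the Laplace equation) specialized to the real axis: `u = Re F` is
harmonic near the axis, `Φ` and `Ψ` are the holomorphic continuations of the
Dirichlet datum `u(x,0)` and the Neumann datum `∂u/∂y(x,0)`, and
`u(z₀) = ½(Φ(z₀) + Φ(conj z₀)) − (i/2) ∫_{conj z₀}^{z₀} Ψ(ζ) dζ`. -/
theorem cauchy_representation_real_axis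
    (Ω : Set ℂ) (hΩ : IsOpen Ω) (hconn : IsConnected Ω)
    (hsym : ∀ z ∈ Ω, (starRingEnd ℂ) z ∈ Ω)
    (hreal : ∃ x : ℝ, (x : ℂ) ∈ Ω)
    (F Φ Ψ : ℂ → ℂ)
    (hF : DifferentiableOn ℂ F Ω)
    (hΦ : DifferentiableOn ℂ Φ Ω) (hΨ : DifferentiableOn ℂ Ψ Ω)
    (hbdD : ∀ x : ℝ, (x : ℂ) ∈ Ω → Φ (x : ℂ) = ((F (x : ℂ)).re : ℂ))
    (hbdN : ∀ x : ℝ, (x : ℂ) ∈ Ω →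
      Ψ (x : ℂ) = ((deriv (fun t : ℝ => (F ((x : ℂ) + (t : ℂ) * I)).re) 0 : ℝ) : ℂ)) :
    ∀ z₀ ∈ Ω, segment ℝ ((starRingEnd ℂ) z₀) z₀ ⊆ Ω →
      ((F z₀).re : ℂ) =
        (Φ z₀ + Φ ((starRingEnd ℂ) z₀)) / 2
          - (I / 2) * segIntegral Ψ ((starRingEnd ℂ) z₀) z₀ := by
  intro z₀ hz₀ hseg
  set G : ℂ → ℂ := (starRingEnd ℂ) ∘ F ∘ (starRingEnd ℂ) with hGdef
  have hFd : ∀ z ∈ Ω, HasDerivAt F (deriv F z) z := fun z hz =>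
    (hF.differentiableAt (hΩ.mem_nhds hz)).hasDerivAt
  have hGd : ∀ z ∈ Ω, HasDerivAt G ((starRingEnd ℂ) (deriv F ((starRingEnd ℂ) z))) z := by
    intro z hz
    have := (hFd _ (hsym z hz)).conj_conj
    rwa [Complex.conj_conj] at this
  have hG : DifferentiableOn ℂ G Ω := fun z hz =>
    (hGd z hz).differentiableAt.differentiableWithinAt
  have hΦeq : Set.EqOn Φ (fun z => (F z + G z) / 2) Ω := by
    refine eqOn_of_real_aux Ω hΩ hconn hreal _ _ hΦ ((hF.add hG).div_const 2) ?_
    intro x hx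
    rw [hbdD x hx, Complex.re_eq_add_conj]
    simp [hGdef]
  set H : ℂ → ℂ := fun z => I / 2 * (F z - G z) with hHdef
  have hH : DifferentiableOn ℂ H Ω := (hF.sub hG).const_mul _
  have hΨeq : Set.EqOn Ψ (deriv H) Ω := by
    refine eqOn_of_real_aux Ω hΩ hconn hreal _ _ hΨ (hH.deriv hΩ) ?_
    intro x hx
    have h1 : HasDerivAt (fun t : ℝ => (x : ℂ) + (t : ℂ) * I) I 0 := by
      have := ((Complex.ofRealCLM.hasDerivAt (x := (0:ℝ))).mul_const I).const_add (x : ℂ)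
      simpa using this
    have h2 : HasDerivAt F (deriv F x) ((x : ℂ) + ((0 : ℝ) : ℂ) * I) := by
      simpa using hFd x hx
    have h3 := h2.comp (0 : ℝ) h1
    have h4 : HasDerivAt (fun t : ℝ => (F ((x : ℂ) + (t : ℂ) * I)).re)
        (deriv F x * I).re 0 :=
      (Complex.reCLM.hasFDerivAt.comp_hasDerivAt (0 : ℝ) h3)
    have h5 : HasDerivAt H _ (x : ℂ) := ((hFd x hx).sub (hGd x hx)).const_mul (I / 2)
    rw [hbdN x hx, h4.deriv, h5.deriv, Complex.re_eq_add_conj]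
    simp
    ring
  have hint : segIntegral Ψ ((starRingEnd ℂ) z₀) z₀ = H z₀ - H ((starRingEnd ℂ) z₀) := by
    unfold segIntegral
    set p := (starRingEnd ℂ) z₀ with hp
    have hmem : ∀ t ∈ Set.uIcc (0:ℝ) 1, p + (t : ℂ) * (z₀ - p) ∈ Ω := by
      intro t ht
      rw [Set.uIcc_of_le zero_le_one] at ht
      apply hseg
      rw [segment_eq_image']
      exact ⟨t, ht, by simp⟩
    have hder : ∀ t ∈ Set.uIcc (0:ℝ) 1, HasDerivAt (fun t : ℝ => H (p + (t : ℂ) * (z₀ - p)))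
        (Ψ (p + (t : ℂ) * (z₀ - p)) * (z₀ - p)) t := by
      intro t ht
      have h1 : HasDerivAt (fun t : ℝ => p + (t : ℂ) * (z₀ - p)) (z₀ - p) t := by
        have := ((Complex.ofRealCLM.hasDerivAt (x := t)).mul_const (z₀ - p)).const_add p
        simpa using this
      rw [hΨeq (hmem t ht)]
      have h2 := (hH.differentiableAt (hΩ.mem_nhds (hmem t ht))).hasDerivAt
      have h3 := HasDerivAt.comp t h2 h1
      exact h3
    have hcont : ContinuousOn (fun t : ℝ => Ψ (p + (t : ℂ) * (z₀ - p)) * (z₀ - p))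
        (Set.uIcc (0:ℝ) 1) := by
      refine ContinuousOn.mul (hΨ.continuousOn.comp ?_ hmem) continuousOn_const
      fun_prop
    have := intervalIntegral.integral_eq_sub_of_hasDerivAt hder hcont.intervalIntegrable
    rw [intervalIntegral.integral_mul_const, mul_comm] at this
    rw [this]
    simp
  rw [hint, hΦeq hz₀, hΦeq (hsym z₀ hz₀), Complex.re_eq_add_conj]
  simp only [hHdef, hGdef, Function.comp_apply, Complex.conj_conj]
  linear_combination (-(1:ℂ) / 4) * (F z₀ - (starRingEnd ℂ) (F ((starRingEnd ℂ) z₀))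
    - F ((starRingEnd ℂ) z₀) + (starRingEnd ℂ) (F z₀)) * (-Complex.I_sq)
end
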